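/- arXiv:1606.02328 — 2 statements merged into one kernel-verified Lean document; each statement's English description precedes it below -/
import Mathlib

section
/- Let X be a nested almost convex set with convex layers R_1, …, R_k, and let 1 ≤ j ≤ k−1 be such that |R_j| ≥ 2 and |R_{j+1}| = 2|R_j|. Write t = |R_j| − 1 and let p : {0,…,t} → R_j be a counterclockwise enumeration. Then there exists a counterclockwise enumeration q : {0,…,2t+1} → R_{j+1} such that for every 0 ≤ i ≤ t the pair (q_{2i}, q_{2i+1}) is adoptable from p_i. -/
open Set

noncomputable section

/-- Points of the plane. -/
abbrev Pt : Type := ℝ × ℝ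

/-- The orientation determinant of the triple `(a, b, c)`:
`c` lies strictly to the left of the directed line from `a` to `b` iff `orient a b c > 0`. -/
def orient (a b c : Pt) : ℝ :=
  (b.1 - a.1) * (c.2 - a.2) - (b.2 - a.2) * (c.1 - a.1)

/-- A set of points is in general position if no three pairwise distinct points are collinear. -/
def GenPos (X : Set Pt) : Prop :=
  ∀ a ∈ X, ∀ b ∈ X, ∀ c ∈ X, a ≠ b → a ≠ c → b ≠ c → orient a b c ≠ 0

/-- The set of extreme points of the convex hull of `S`. -/
def extremePts (S : Set Pt) : Set Pt := Set.extremePoints ℝ (convexHull ℝ S)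

/-- Remove the extreme points of the convex hull (one peeling step of convex layers). -/
def peel (S : Set Pt) : Set Pt := S \ extremePts S

/-- `X` has exactly `k` convex layers. -/
def HasLayers (X : Set Pt) (k : ℕ) : Prop :=
  peel^[k] X = ∅ ∧ ∀ j < k, peel^[j] X ≠ ∅

/-- `X_j`, the union of the `j` innermost convex layers (when `X` has `k` layers). -/
def layerSub (X : Set Pt) (k j : ℕ) : Set Pt := peel^[k - j] X

/-- `R_j`, the `j`-th convex layer of `X` (when `X` has `k` layers), `R_1` innermost. -/
def layer (X : Set Pt) (k j : ℕ) : Set Pt := extremePts (layerSub X k j)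

/-- `X` is a nested almost convex set. -/
def IsNACS (X : Set Pt) : Prop :=
  X.Finite ∧ X.Nonempty ∧ GenPos X ∧
  ∀ k, HasLayers X k →
    ∀ j, 1 ≤ j → j ≤ k →
      ∀ a ∈ layer X k j, ∀ b ∈ layer X k j, ∀ c ∈ layer X k j,
        a ≠ b → a ≠ c → b ≠ c →
        ∃! p : Pt, p ∈ layerSub X k (j - 1) ∩ interior (convexHull ℝ ({a, b, c} : Set Pt))

/-- `q` is a counterclockwise enumeration of `S`. -/
def CCWEnum {m : ℕ} (S : Set Pt) (q : Fin m → Pt) : Prop :=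
  Function.Injective q ∧ Set.range q = S ∧
  ∀ a b c : Fin m, a < b → b < c → 0 < orient (q a) (q b) (q c)

/-- The ordered pair `(q1, q2)` of points of `R` is adoptable from `p`. -/
def AdoptablePair (R : Set Pt) (p q1 q2 : Pt) : Prop :=
  ∀ q3 ∈ R \ ({q1, q2} : Set Pt), p ∈ interior (convexHull ℝ ({q1, q2, q3} : Set Pt))

/-- The `i`-th binary string of length `j` in lexicographic order (`false` before `true`). -/
def strOfNat (j i : ℕ) : List Bool :=
  (List.range j).map fun t => i.testBit (j - 1 - t)

/-- The numeric (lexicographic) rank of a binary string among strings of its length. -/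
def natOfStr (s : List Bool) : ℕ := s.foldl (fun n b => 2 * n + b.toNat) 0

/-- The leftmost `k`-level descendant of the node `s`. -/
def firstStr (k : ℕ) (s : List Bool) : List Bool := s ++ List.replicate (k - s.length) false

/-- The rightmost `k`-level descendant of the node `s`. -/
def lastStr (k : ℕ) (s : List Bool) : List Bool := s ++ List.replicate (k - s.length) true

/-- Non-root nodes of the tree `T₁(k)`: binary strings of length `1..k`. -/
def ValidNode1 (k : ℕ) (s : List Bool) : Prop := 1 ≤ s.length ∧ s.length ≤ k

/-- A type-1 labeling of `X`, given by its label function `x` (the inverse of `ψ`). -/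
def IsLabeling1 (k : ℕ) (X : Set Pt) (x : List Bool → Pt) : Prop :=
  Set.InjOn x {s | ValidNode1 k s} ∧ x '' {s | ValidNode1 k s} = X

/-- A type-1 labeling is nested. -/
def Nested1 (k : ℕ) (X : Set Pt) (x : List Bool → Pt) : Prop :=
  ∀ j, 1 ≤ j → j ≤ k →
    CCWEnum (layer X k j) fun i : Fin (2 ^ j) => x (strOfNat j i.val)

/-- A type-1 labeling is adoptable. -/
def Adoptable1 (k : ℕ) (X : Set Pt) (x : List Bool → Pt) : Prop :=
  ∀ s : List Bool, 1 ≤ s.length → s.length + 1 ≤ k →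
    AdoptablePair (layer X k (s.length + 1)) (x s) (x (s ++ [false])) (x (s ++ [true]))

/-- `previous[R_k(u)]` for a type-1 labeling: the cyclic predecessor (in the left-to-right,
i.e. counterclockwise, order of the `k`-level) of `first[R_k(u)]`. -/
def prev1 (k : ℕ) (x : List Bool → Pt) (s : List Bool) : Pt :=
  x (strOfNat k ((natOfStr (firstStr k s) + (2 ^ k - 1)) % 2 ^ k))

/-- `next[R_k(u)]` for a type-1 labeling: the cyclic successor of `last[R_k(u)]`. -/
def next1 (k : ℕ) (x : List Bool → Pt) (s : List Bool) : Pt :=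
  x (strOfNat k ((natOfStr (lastStr k s) + 1) % 2 ^ k))

/-- A type-1 labeling is well laid. -/
def WellLaid1 (k : ℕ) (x : List Bool → Pt) : Prop :=
  ∀ s : List Bool, 1 ≤ s.length → s.length ≤ k →
    x s ∈ convexHull ℝ ({prev1 k x s, x (firstStr k s), x (lastStr k s)} : Set Pt) ∧
    x s ∈ convexHull ℝ ({x (firstStr k s), x (lastStr k s), next1 k x s} : Set Pt)

/-- `X_u` for a type-1 labeling: the labels of the proper descendants of `s`. -/
def descSet1 (k : ℕ) (x : List Bool → Pt) (s : List Bool) : Set Pt :=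
  x '' {t | ValidNode1 k t ∧ s <+: t ∧ s ≠ t}

/-- `X̄_u = X_u ∪ {x_u}` for a type-1 labeling. -/
def barSet1 (k : ℕ) (x : List Bool → Pt) (s : List Bool) : Set Pt :=
  insert (x s) (descSet1 k x s)

/-- A type-1 labeling is an internal separation. -/
def InternalSep1 (k : ℕ) (X : Set Pt) (x : List Bool → Pt) : Prop :=
  ∀ s : List Bool, s.length + 1 ≤ k →
    ∀ y ∈ X \ descSet1 k x s,
      ∀ a ∈ barSet1 k x (s ++ [false]), ∀ b ∈ barSet1 k x (s ++ [true]),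
        0 < orient a b y

/-- A type-1 labeling is an external separation. -/
def ExternalSep1 (k : ℕ) (X : Set Pt) (x : List Bool → Pt) : Prop :=
  ∀ s : List Bool, 1 ≤ s.length → s.length + 1 ≤ k →
    ∀ y ∈ X \ barSet1 k x s,
      (∀ a ∈ barSet1 k x (s ++ [false]), 0 < orient a (x s) y) ∧
      (∀ b ∈ barSet1 k x (s ++ [true]), 0 < orient (x s) b y)

/-- Nodes of the tree `T₂(k)`: the root `none`, and pairs `(c, s)`. -/
abbrev Node2 : Type := Option (Fin 3 × List Bool)

/-- Valid nodes of `T₂(k)`: the root, and pairs `(c, s)` with `|s| ≤ k - 2`. -/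
def ValidNode2 (k : ℕ) : Node2 → Prop
  | none => True
  | some (_, s) => s.length + 2 ≤ k

/-- A type-2 labeling of `X`, given by its label function `x` (the inverse of `ψ`). -/
def IsLabeling2 (k : ℕ) (X : Set Pt) (x : Node2 → Pt) : Prop :=
  Set.InjOn x {u | ValidNode2 k u} ∧ x '' {u | ValidNode2 k u} = X

/-- The `i`-th node (left-to-right) of the `(j+2)`-level of `T₂(k)`. -/
def node2At (j i : ℕ) : Node2 :=
  some (⟨i / 2 ^ j % 3, by omega⟩, strOfNat j (i % 2 ^ j))

/-- A type-2 labeling is nested. -/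
def Nested2 (k : ℕ) (X : Set Pt) (x : Node2 → Pt) : Prop :=
  CCWEnum (layer X k 1) (fun _ : Fin 1 => x none) ∧
  ∀ j : ℕ, j + 2 ≤ k →
    CCWEnum (layer X k (j + 2)) fun i : Fin (3 * 2 ^ j) => x (node2At j i.val)

/-- A type-2 labeling is adoptable. -/
def Adoptable2 (k : ℕ) (X : Set Pt) (x : Node2 → Pt) : Prop :=
  ∀ (c : Fin 3) (s : List Bool), s.length + 3 ≤ k →
    AdoptablePair (layer X k (s.length + 3)) (x (some (c, s)))
      (x (some (c, s ++ [false]))) (x (some (c, s ++ [true])))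

/-- `previous[R_k(u)]` for a type-2 labeling, `u = (c, s)`. -/
def prev2 (k : ℕ) (x : Node2 → Pt) (c : Fin 3) (s : List Bool) : Pt :=
  x (node2At (k - 2)
      ((c.val * 2 ^ (k - 2) + natOfStr (firstStr (k - 2) s) + (3 * 2 ^ (k - 2) - 1)) %
        (3 * 2 ^ (k - 2))))

/-- `next[R_k(u)]` for a type-2 labeling, `u = (c, s)`. -/
def next2 (k : ℕ) (x : Node2 → Pt) (c : Fin 3) (s : List Bool) : Pt :=
  x (node2At (k - 2)
      ((c.val * 2 ^ (k - 2) + natOfStr (lastStr (k - 2) s) + 1) % (3 * 2 ^ (k - 2))))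

/-- A type-2 labeling is well laid (the root is the only node with `R_k(u) = R_k`). -/
def WellLaid2 (k : ℕ) (x : Node2 → Pt) : Prop :=
  ∀ (c : Fin 3) (s : List Bool), s.length + 2 ≤ k →
    x (some (c, s)) ∈ convexHull ℝ
      ({prev2 k x c s, x (some (c, firstStr (k - 2) s)),
        x (some (c, lastStr (k - 2) s))} : Set Pt) ∧
    x (some (c, s)) ∈ convexHull ℝ
      ({x (some (c, firstStr (k - 2) s)), x (some (c, lastStr (k - 2) s)),
        next2 k x c s} : Set Pt)

/-- `X_u` for a type-2 labeling and a non-root node `u = (c, s)`. -/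
def descSet2 (k : ℕ) (x : Node2 → Pt) (c : Fin 3) (s : List Bool) : Set Pt :=
  x '' {u | ∃ t : List Bool, u = some (c, t) ∧ t.length + 2 ≤ k ∧ s <+: t ∧ s ≠ t}

/-- `X̄_u = X_u ∪ {x_u}` for a type-2 labeling and a non-root node `u = (c, s)`. -/
def barSet2 (k : ℕ) (x : Node2 → Pt) (c : Fin 3) (s : List Bool) : Set Pt :=
  insert (x (some (c, s))) (descSet2 k x c s)

/-- A type-2 labeling is an internal separation. -/
def InternalSep2 (k : ℕ) (X : Set Pt) (x : Node2 → Pt) : Prop :=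
  (∀ (c : Fin 3) (s : List Bool), s.length + 3 ≤ k →
    ∀ y ∈ X \ descSet2 k x c s,
      ∀ a ∈ barSet2 k x c (s ++ [false]), ∀ b ∈ barSet2 k x c (s ++ [true]),
        0 < orient a b y) ∧
  (∀ i : Fin 3,
    ∀ y ∈ X \ (barSet2 k x i [] ∪ barSet2 k x (i + 1) []),
      ∀ a ∈ barSet2 k x i [], ∀ b ∈ barSet2 k x (i + 1) [],
        0 < orient a b y)

/-- A type-2 labeling is an external separation. -/
def ExternalSep2 (k : ℕ) (X : Set Pt) (x : Node2 → Pt) : Prop :=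
  ∀ (c : Fin 3) (s : List Bool), s.length + 3 ≤ k →
    ∀ y ∈ X \ barSet2 k x c s,
      (∀ a ∈ barSet2 k x c (s ++ [false]), 0 < orient a (x (some (c, s))) y) ∧
      (∀ b ∈ barSet2 k x c (s ++ [true]), 0 < orient (x (some (c, s))) b y)

/-- One corner-refinement step: from `α_s = (q, o, p)` to `α_{s0}` (for `b = false`)
or `α_{s1}` (for `b = true`). -/
def cornerStep (α : Pt × Pt × Pt) (b : Bool) : Pt × Pt × Pt :=
  let q := α.1
  let o := α.2.1
  let p := α.2.2
  if b then (o + (1 / 5 : ℝ) • (q - o), o + (1 / 5 : ℝ) • (p - o), o + (2 / 5 : ℝ) • (p - o))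
  else (o + (2 / 5 : ℝ) • (q - o), o + (1 / 5 : ℝ) • (q - o), o + (1 / 5 : ℝ) • (p - o))

/-- The corner `α_s = (q_s, o_s, p_s)` assigned to the binary string `s` (with parameter `k`). -/
def corner (k : ℕ) (s : List Bool) : Pt × Pt × Pt :=
  s.foldl cornerStep
    (((0 : ℝ), (2 * 5 ^ (k + 1) : ℝ)), ((0 : ℝ), (0 : ℝ)), ((2 * 5 ^ (k + 1) : ℝ), (0 : ℝ)))

/-- The point `y_v` for a binary string `v = s ++ [b]` of positive length. -/
def ypt (k : ℕ) (v : List Bool) : Pt :=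
  let α := corner k v.dropLast
  if v.getLastD false then α.2.1 + (1 / 5 : ℝ) • (α.2.2 - α.2.1)
  else α.2.1 + (1 / 5 : ℝ) • (α.1 - α.2.1)

/-- The point `x_s`: the midpoint of `y_{s·0^(k+1−|s|)}` and `y_{s·1^(k+1−|s|)}`. -/
def xpt (k : ℕ) (s : List Bool) : Pt :=
  (1 / 2 : ℝ) •
    (ypt k (s ++ List.replicate (k + 1 - s.length) false) +
      ypt k (s ++ List.replicate (k + 1 - s.length) true))


theorem o_cyc (a b c : Pt) : orient a b c = orient b c a := by unfold orient; ring
theorem o_cyc2 (a b c : Pt) : orient a b c = orient c a b := by unfold orient; ring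
theorem o_sw (a b c : Pt) : orient a b c = - orient a c b := by unfold orient; ring
theorem o_plu (p a b u y : Pt) : orient p a b * orient p u y - orient p a u * orient p b y
    + orient p a y * orient p b u = 0 := by unfold orient; ring
theorem o_sum (p a b c : Pt) : orient a b c = orient p a b + orient p b c + orient p c a := by
  unfold orient; ring
theorem o_self1 (a b : Pt) : orient a b a = 0 := by unfold orient; ring
theorem o_self2 (a b : Pt) : orient a b b = 0 := by unfold orient; ring
theorem o_self3 (a b : Pt) : orient a a b = 0 := by unfold orient; ring

theorem o_aff (a b x y : Pt) (s t : ℝ) (h : s + t = 1) :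
    orient a b (s • x + t • y) = s * orient a b x + t * orient a b y := by
  have : s = 1 - t := by linarith
  subst this
  simp only [orient, Prod.fst_add, Prod.snd_add, Prod.smul_fst, Prod.smul_snd, smul_eq_mul]
  ring

theorem o_convex_pos (a b : Pt) : Convex ℝ {x | 0 < orient a b x} := by
  intro x hx y hy s t hs ht hst
  simp only [mem_ofPred_eq] at *
  rw [o_aff _ _ _ _ _ _ hst]
  rcases hs.eq_or_lt with rfl | hs
  · have : t = 1 := by linarith
    subst this; linarith
  · nlinarith [mul_pos hs hx, mul_nonneg ht hy.le]

theorem o_convex_nonneg (a b : Pt) : Convex ℝ {x | 0 ≤ orient a b x} := by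
  intro x hx y hy s t hs ht hst
  simp only [mem_ofPred_eq] at *
  rw [o_aff _ _ _ _ _ _ hst]
  positivity

theorem hull_nonneg {a b : Pt} {S : Set Pt} (h : ∀ s ∈ S, 0 ≤ orient a b s) {x : Pt}
    (hx : x ∈ convexHull ℝ S) : 0 ≤ orient a b x :=
  convexHull_min (show S ⊆ {x | 0 ≤ orient a b x} from h) (o_convex_nonneg a b) hx

theorem hull_pos {a b : Pt} {S : Set Pt} (h : ∀ s ∈ S, 0 < orient a b s) {x : Pt}
    (hx : x ∈ convexHull ℝ S) : 0 < orient a b x :=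
  convexHull_min (show S ⊆ {x | 0 < orient a b x} from h) (o_convex_pos a b) hx

theorem hull_insert_pos {a b u : Pt} {S : Set Pt} (hS : S.Nonempty)
    (h : ∀ s ∈ S, 0 < orient a b s) (hu : orient a b u = 0) {x : Pt}
    (hx : x ∈ convexHull ℝ (insert u S)) (h0 : orient a b x ≤ 0) : x = u := by
  rw [convexHull_insert hS, mem_convexJoin] at hx
  obtain ⟨u', hu', s, hs, hx⟩ := hx
  rw [mem_singleton_iff] at hu'
  subst hu'
  have hs' := hull_pos h hs
  obtain ⟨c, d, hc, hd, hcd, rfl⟩ := hx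
  rw [o_aff _ _ _ _ _ _ hcd, hu] at h0
  have : d = 0 := by
    by_contra hne
    have : 0 < d := lt_of_le_of_ne hd (Ne.symm hne)
    nlinarith [mul_pos this hs']
  subst this
  have : c = 1 := by linarith
  subst this
  simp

theorem mem_tri {a b c x : Pt} (h1 : 0 < orient a b x) (h2 : 0 < orient b c x)
    (h3 : 0 < orient c a x) : x ∈ convexHull ℝ ({a, b, c} : Set Pt) := by
  have hsum : orient a b c = orient b c x + orient c a x + orient a b x := by
    unfold orient; ring
  have hD : 0 < orient a b c := by linarith
  have hx : x = (orient b c x / orient a b c) • a + (orient c a x / orient a b c) • b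
      + (orient a b x / orient a b c) • c := by
    have hne := hD.ne'
    ext
    · simp only [Prod.fst_add, Prod.smul_fst, smul_eq_mul]
      field_simp
      unfold orient; ring
    · simp only [Prod.snd_add, Prod.smul_snd, smul_eq_mul]
      field_simp
      unfold orient; ring
  rw [hx]
  have hc := convex_convexHull ℝ ({a, b, c} : Set Pt)
  have ha : a ∈ convexHull ℝ ({a, b, c} : Set Pt) := subset_convexHull ℝ _ (by simp)
  have hb : b ∈ convexHull ℝ ({a, b, c} : Set Pt) := subset_convexHull ℝ _ (by simp)
  have hcc : c ∈ convexHull ℝ ({a, b, c} : Set Pt) := subset_convexHull ℝ _ (by simp)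
  have := hc.sum_mem (t := (Finset.univ : Finset (Fin 3)))
    (w := ![orient b c x / orient a b c, orient c a x / orient a b c, orient a b x / orient a b c])
    (z := ![a, b, c]) ?_ ?_ ?_
  · simpa [Fin.sum_univ_three] using this
  · intro i _; fin_cases i <;> simp <;> positivity
  · simp [Fin.sum_univ_three]; rw [← add_div, ← add_div, ← hsum, div_self hD.ne']
  · intro i _; fin_cases i <;> simp <;> assumption

theorem o_cont (a b : Pt) : Continuous (fun x => orient a b x) := by
  unfold orient; fun_prop

theorem mem_int_tri {a b c x : Pt} (h1 : 0 < orient a b x) (h2 : 0 < orient b c x)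
    (h3 : 0 < orient c a x) : x ∈ interior (convexHull ℝ ({a, b, c} : Set Pt)) := by
  have hopen : IsOpen ({x | 0 < orient a b x} ∩ ({x | 0 < orient b c x} ∩ {x | 0 < orient c a x})) :=
    (isOpen_lt continuous_const (o_cont a b)).inter
      ((isOpen_lt continuous_const (o_cont b c)).inter (isOpen_lt continuous_const (o_cont c a)))
  exact interior_maximal (fun y hy => mem_tri hy.1 hy.2.1 hy.2.2) hopen ⟨h1, h2, h3⟩

/-- An extreme point of a hull lies in no triangle on other points of the hull. -/
theorem extreme_tri {Z : Set Pt} {x : Pt} (hx : x ∈ extremePts Z) {S : Set Pt}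
    (hS : S ⊆ convexHull ℝ Z) (h : x ∈ convexHull ℝ S) : x ∈ S := by
  have h1 : convexHull ℝ S ⊆ convexHull ℝ Z := convexHull_min hS (convex_convexHull ℝ Z)
  exact extremePoints_convexHull_subset
    (inter_extremePoints_subset_extremePoints_of_subset h1 ⟨h, hx⟩)

theorem hull_extremePts {Z : Set Pt} (hZ : Z.Finite) :
    convexHull ℝ (extremePts Z) = convexHull ℝ Z := by
  have h := closure_convexHull_extremePoints (hZ.isCompact_convexHull ℝ) (convex_convexHull ℝ Z)
  have hf : (extremePts Z).Finite := hZ.subset extremePoints_convexHull_subset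
  change closure (convexHull ℝ (extremePts Z)) = _ at h
  rwa [(hf.isClosed_convexHull ℝ).closure_eq] at h

theorem ccw_of_edges {m : ℕ} {Z : Set Pt} (hg : GenPos Z) (hsub : extremePts Z ⊆ Z)
    (q : Fin m → Pt) (hinj : Function.Injective q) (hq : ∀ i, q i ∈ extremePts Z)
    (hedge : ∀ (s : ℕ) (hs : s + 1 < m) (r : Fin m), r.val ≠ s → r.val ≠ s + 1 →
      0 < orient (q ⟨s, by omega⟩) (q ⟨s + 1, hs⟩) (q r)) :
    ∀ a b c : Fin m, a < b → b < c → 0 < orient (q a) (q b) (q c) := by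
  intro a b c hab hbc
  obtain ⟨a, ha⟩ := a
  obtain ⟨b, hb⟩ := b
  obtain ⟨c, hc⟩ := c
  simp only [Fin.mk_lt_mk] at hab hbc
  induction b, (show a + 1 ≤ b from hab) using Nat.le_induction with
  | base => exact hedge a (by omega) ⟨c, hc⟩ (by simp; omega) (by simp; omega)
  | succ b hab' ih =>
    have h1 := ih (by omega) (by omega) (by omega)
    have h2 := hedge b (by omega) ⟨c, hc⟩ (by simp; omega) (by simp; omega)
    have hne := hg _ (hsub (hq ⟨a, ha⟩)) _ (hsub (hq ⟨b + 1, hb⟩)) _ (hsub (hq ⟨c, hc⟩))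
      (by intro h; have := hinj h; simp at this; omega)
      (by intro h; have := hinj h; simp at this; omega)
      (by intro h; have := hinj h; simp at this; omega)
    by_contra hcon
    have h3 : 0 < orient (q ⟨b + 1, hb⟩) (q ⟨a, ha⟩) (q ⟨c, hc⟩) := by
      have : orient (q ⟨b + 1, hb⟩) (q ⟨a, ha⟩) (q ⟨c, hc⟩)
        = - orient (q ⟨a, ha⟩) (q ⟨b + 1, hb⟩) (q ⟨c, hc⟩) := by unfold orient; ring
      have := lt_of_le_of_ne (not_lt.mp hcon) hne
      linarith
    have h4 := mem_tri h1 h2 h3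
    have h5 := extreme_tri (hq ⟨c, hc⟩) (S := {q ⟨a, ha⟩, q ⟨b, by omega⟩, q ⟨b + 1, hb⟩}) (by
      rintro z (rfl | rfl | rfl) <;> exact subset_convexHull ℝ _ (hsub (hq _))) h4
    rcases h5 with h | h | h <;> · have := hinj h; simp at this; omega

/-- In the corner at `p` between `p'` (previous) and `p''` (next). -/
theorem cornerK {Z : Set Pt} (hg : GenPos Z) {p p' p'' u s : Pt} (hp : p ∈ Z) (hp' : p' ∈ Z)
    (hp'' : p'' ∈ Z) (hs : s ∈ Z) (h1 : p ≠ p') (h2 : p ≠ p'')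
    (hab : 0 ≤ orient p p'' p') (hu1 : 0 < orient p p' u) (hu2 : 0 < orient p p'' u)
    (hs1 : orient p p' s ≤ 0) (hs2 : 0 ≤ orient p p'' s) : orient p u s ≤ 0 := by
  have hP := o_plu p p'' p' u s
  by_cases h : p' = p''
  · subst h
    have h0 : orient p p' s = 0 := le_antisymm hs1 hs2
    by_cases hps : p = s
    · subst hps; rw [o_self1]
    by_cases hps' : p' = s
    · subst hps'; rw [o_sw]; linarith
    · exact absurd h0 (hg _ hp _ hp' _ hs h1 hps hps')
  · have hne := hg _ hp _ hp'' _ hp' h2 h1 (Ne.symm h)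
    have hpos : 0 < orient p p'' p' := lt_of_le_of_ne hab (Ne.symm hne)
    by_contra hc
    push Not at hc
    nlinarith [mul_pos hpos hc, mul_nonneg hu2.le (neg_nonneg.mpr hs1), mul_nonneg hs2 hu1.le]

theorem cornerK' {Z : Set Pt} (hg : GenPos Z) {p p' p'' v s : Pt} (hp : p ∈ Z) (hp' : p' ∈ Z)
    (hp'' : p'' ∈ Z) (hs : s ∈ Z) (h1 : p ≠ p') (h2 : p ≠ p'')
    (hab : 0 ≤ orient p p'' p') (hv1 : orient p p' v < 0) (hv2 : orient p p'' v < 0)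
    (hs1 : orient p p' s ≤ 0) (hs2 : 0 ≤ orient p p'' s) : 0 ≤ orient p v s := by
  have hP := o_plu p p'' p' v s
  by_cases h : p' = p''
  · subst h
    have h0 : orient p p' s = 0 := le_antisymm hs1 hs2
    by_cases hps : p = s
    · subst hps; rw [o_self1]
    by_cases hps' : p' = s
    · subst hps'; rw [o_sw]; linarith
    · exact absurd h0 (hg _ hp _ hp' _ hs h1 hps hps')
  · have hne := hg _ hp _ hp'' _ hp' h2 h1 (Ne.symm h)
    have hpos : 0 < orient p p'' p' := lt_of_le_of_ne hab (Ne.symm hne)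
    by_contra hc
    push Not at hc
    nlinarith [mul_pos hpos (neg_pos.mpr hc), mul_nonneg (neg_nonneg.mpr hv2.le) (neg_nonneg.mpr hs1),
      mul_nonneg hs2 (neg_nonneg.mpr hv1.le)]

theorem corner_exists {Z Y Q : Set Pt} (hg : GenPos Z) (hYZ : Y ⊆ Z) (hQZ : Q ⊆ Z)
    (hQY : ∀ q ∈ Q, ∀ y ∈ Y, q ≠ y) {p p' p'' : Pt} (hp : p ∈ Y) (hp' : p' ∈ Y) (hp'' : p'' ∈ Y)
    (h1 : p ≠ p') (h2 : p ≠ p'')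
    (hprevY : ∀ y ∈ Y, 0 ≤ orient p' p y) (hnextY : ∀ y ∈ Y, 0 ≤ orient p p'' y)
    (hprev : ∃ x y, x ∈ Q ∧ y ∈ Q ∧ x ≠ y ∧ ∀ q ∈ Q, orient p' p q < 0 ↔ q = x ∨ q = y)
    (hnext : ∃ x y, x ∈ Q ∧ y ∈ Q ∧ x ≠ y ∧ ∀ q ∈ Q, orient p p'' q < 0 ↔ q = x ∨ q = y)
    (hdis : ∀ q ∈ Q, orient p' p q < 0 → orient p p'' q < 0 → False)
    (htri : ∀ a ∈ Q, ∀ b ∈ Q, ∀ c ∈ Q, a ≠ b → a ≠ c → b ≠ c →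
      ∃ y ∈ Y, y ∈ convexHull ℝ ({a, b, c} : Set Pt))
    (hhull : p ∈ convexHull ℝ Q) :
    ∃ u v, u ∈ Q ∧ v ∈ Q ∧ orient p' p u < 0 ∧ orient p p'' v < 0 ∧ 0 < orient u v p ∧
      ∀ q ∈ Q, q ≠ u → q ≠ v → 0 < orient u p q ∧ 0 < orient p v q := by
  -- general position at `p`
  have hgp : ∀ a ∈ Q, ∀ b ∈ Q, a ≠ b → orient p a b ≠ 0 := fun a ha b hb hab =>
    hg _ (hYZ hp) _ (hQZ ha) _ (hQZ hb) (hQY a ha p hp).symm (hQY b hb p hp).symm hab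
  have hgp' : ∀ a ∈ Q, orient p p' a ≠ 0 := fun a ha =>
    hg _ (hYZ hp) _ (hYZ hp') _ (hQZ ha) h1 (hQY a ha p hp).symm (hQY a ha p' hp').symm
  have hgp'' : ∀ a ∈ Q, orient p p'' a ≠ 0 := fun a ha =>
    hg _ (hYZ hp) _ (hYZ hp'') _ (hQZ ha) h2 (hQY a ha p hp).symm (hQY a ha p'' hp'').symm
  have sw : ∀ a, orient p' p a = - orient p p' a := fun a => by unfold orient; ring
  -- orient the pairs
  have hprev2 : ∃ x u, x ∈ Q ∧ u ∈ Q ∧ x ≠ u ∧ 0 < orient p x u ∧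
      ∀ q ∈ Q, 0 < orient p p' q ↔ q = x ∨ q = u := by
    obtain ⟨x, y, hx, hy, hxy, h⟩ := hprev
    rcases lt_or_gt_of_ne (hgp x hx y hy hxy) with h' | h'
    · refine ⟨y, x, hy, hx, hxy.symm, by rw [o_sw]; linarith, fun q hq => ?_⟩
      rw [or_comm, ← h q hq, sw]; constructor <;> intro <;> linarith
    · refine ⟨x, y, hx, hy, hxy, h', fun q hq => ?_⟩
      rw [← h q hq, sw]; constructor <;> intro <;> linarith
  have hnext2 : ∃ v w, v ∈ Q ∧ w ∈ Q ∧ v ≠ w ∧ 0 < orient p v w ∧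
      ∀ q ∈ Q, orient p p'' q < 0 ↔ q = v ∨ q = w := by
    obtain ⟨x, y, hx, hy, hxy, h⟩ := hnext
    rcases lt_or_gt_of_ne (hgp x hx y hy hxy) with h' | h'
    · exact ⟨y, x, hy, hx, hxy.symm, by rw [o_sw]; linarith, fun q hq => by
        rw [or_comm, ← h q hq]⟩
    · exact ⟨x, y, hx, hy, hxy, h', h⟩
  obtain ⟨x, u, hx, hu, hxu, hxup, hA⟩ := hprev2
  obtain ⟨v, w, hv, hw, hvw, hvwp, hB⟩ := hnext2
  have hA1 : ∀ q ∈ Q, 0 < orient p p' q → 0 < orient p p'' q := fun q hq h => by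
    rcases lt_or_gt_of_ne (hgp'' q hq) with h' | h'
    · exact (hdis q hq (by rw [sw]; linarith) h').elim
    · exact h'
  have hB1 : ∀ q ∈ Q, orient p p'' q < 0 → orient p p' q < 0 := fun q hq h => by
    rcases lt_or_gt_of_ne (hgp' q hq) with h' | h'
    · exact h'
    · exact (hdis q hq (by rw [sw]; linarith) h).elim
  have hu1 : 0 < orient p p' u := (hA u hu).mpr (Or.inr rfl)
  have hx1 : 0 < orient p p' x := (hA x hx).mpr (Or.inl rfl)
  have hv2 : orient p p'' v < 0 := (hB v hv).mpr (Or.inl rfl)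
  have hw2 : orient p p'' w < 0 := (hB w hw).mpr (Or.inr rfl)
  have hu2 := hA1 u hu hu1
  have hx2 := hA1 x hx hx1
  have hv1 := hB1 v hv hv2
  have hw1 := hB1 w hw hw2
  have huv : u ≠ v := by rintro rfl; linarith
  have huw : u ≠ w := by rintro rfl; linarith
  have hxv : x ≠ v := by rintro rfl; linarith
  have hab := hnextY p' hp'
  have KY : ∀ y ∈ Y, orient p u y ≤ 0 := fun y hy =>
    cornerK hg (hYZ hp) (hYZ hp') (hYZ hp'') (hYZ hy) h1 h2 hab hu1 hu2
      (by have := hprevY y hy; rw [sw] at this; linarith) (hnextY y hy)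
  have KY' : ∀ y ∈ Y, 0 ≤ orient p v y := fun y hy =>
    cornerK' hg (hYZ hp) (hYZ hp') (hYZ hp'') (hYZ hy) h1 h2 hab hv1 hv2
      (by have := hprevY y hy; rw [sw] at this; linarith) (hnextY y hy)
  have main : ∀ q ∈ Q, q ≠ u → q ≠ v → orient p u q < 0 ∧ 0 < orient p v q := by
    intro q hq hqu hqv
    by_cases hqA : 0 < orient p p' q
    · obtain rfl : q = x := by
        rcases (hA q hq).mp hqA with h | h
        · exact h
        · exact absurd h hqu
      refine ⟨by rw [o_sw]; linarith, ?_⟩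
      by_contra hc
      have hc : orient p v q < 0 := lt_of_le_of_ne (not_lt.mp hc) (hgp v hv q hq hqv.symm)
      rcases lt_or_gt_of_ne (hgp v hv u hu huv.symm) with h' | h'
      · obtain ⟨y, hy, hyt⟩ := htri v hv q hq u hu hqv.symm huv.symm hqu
        have : y = v := hull_insert_pos (a := v) (b := p) (S := {q, u}) ⟨q, by simp⟩
          (by
            have e : ∀ s, orient v p s = - orient p v s := fun a => by unfold orient; ring
            rintro s (rfl | rfl) <;> rw [e] <;> linarith) (o_self1 _ _) hyt (by
              have e : ∀ s, orient v p s = - orient p v s := fun a => by unfold orient; ring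
              rw [e]; linarith [KY' y hy])
        exact hQY v hv y hy this.symm
      · have hP := o_plu p p' v q u
        nlinarith [mul_pos (neg_pos.mpr hv1) hxup, mul_pos hx1 h', mul_pos hu1 (neg_pos.mpr hc)]
    · have hqA : orient p p' q < 0 := lt_of_le_of_ne (not_lt.mp hqA) (hgp' q hq)
      by_cases hqB : orient p p'' q < 0
      · obtain rfl : q = w := by
          rcases (hB q hq).mp hqB with h | h
          · exact absurd h hqv
          · exact h
        refine ⟨?_, hvwp⟩
        by_contra hc
        have hc : 0 < orient p u q := lt_of_le_of_ne (not_lt.mp hc) (hgp u hu q hq huw).symm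
        rcases lt_or_gt_of_ne (hgp u hu v hv huv) with h' | h'
        · have hP := o_plu p p'' u v q
          nlinarith [mul_pos hu2 hvwp, mul_pos (neg_pos.mpr hv2) hc,
            mul_pos (neg_pos.mpr hw2) (neg_pos.mpr h')]
        · obtain ⟨y, hy, hyt⟩ := htri u hu v hv q hq huv huw hvw
          have : y = u := hull_insert_pos (a := p) (b := u) (S := {v, q}) ⟨v, by simp⟩
            (by rintro s (rfl | rfl) <;> assumption) (o_self2 _ _) hyt (KY y hy)
          exact hQY u hu y hy this.symm
      · have hqB := not_lt.mp hqB
        refine ⟨lt_of_le_of_ne (cornerK hg (hYZ hp) (hYZ hp') (hYZ hp'') (hQZ hq) h1 h2 hab hu1 hu2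
          hqA.le hqB) (hgp u hu q hq hqu.symm), lt_of_le_of_ne (cornerK' hg (hYZ hp) (hYZ hp')
          (hYZ hp'') (hQZ hq) h1 h2 hab hv1 hv2 hqA.le hqB) (hgp v hv q hq hqv.symm).symm⟩
  refine ⟨u, v, hu, hv, by rw [sw]; linarith, hv2, ?_, fun q hq hqu hqv => ?_⟩
  · rw [o_cyc2]
    by_contra hc
    have hc : orient p u v < 0 := lt_of_le_of_ne (not_lt.mp hc) (hgp u hu v hv huv)
    have e : ∀ s, orient u p s = - orient p u s := fun a => by unfold orient; ring
    have : p = u := hull_insert_pos (a := u) (b := p) (u := u) (S := Q \ {u})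
      ⟨v, hv, fun h => huv h.symm⟩ (by
        rintro s ⟨hs, hsu⟩
        rw [e]
        by_cases hsv : s = v
        · subst hsv; linarith
        · linarith [(main s hs hsu hsv).1]) (o_self1 _ _)
        (by rw [insert_sdiff_singleton, insert_eq_of_mem hu]; exact hhull) (by rw [o_self2])
    exact hQY u hu p hp this.symm
  · have e : ∀ s, orient u p s = - orient p u s := fun a => by unfold orient; ring
    have := main q hq hqu hqv
    exact ⟨by rw [e]; linarith, this.2⟩

theorem count_lemma {α : Type*} [DecidableEq α] {n : ℕ} (Q : Finset α) (hQ : Q.card = 2 * n)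
    (r : Fin n → α → Prop) (hcov : ∀ q ∈ Q, ∃ i, r i q)
    (hle : ∀ i, ∀ a ∈ Q, ∀ b ∈ Q, ∀ c ∈ Q, a ≠ b → a ≠ c → b ≠ c → r i a → r i b → r i c → False) :
    (∀ i, ∃ x y, x ∈ Q ∧ y ∈ Q ∧ x ≠ y ∧ ∀ q ∈ Q, r i q ↔ q = x ∨ q = y) ∧
    ∀ q ∈ Q, ∀ i i', r i q → r i' q → i = i' := by
  classical
  have hd := Finset.sum_card_bipartiteAbove_eq_sum_card_bipartiteBelow (s := Finset.univ) (t := Q) r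
  have h2 : ∀ i ∈ (Finset.univ : Finset (Fin n)), (Finset.bipartiteAbove r Q i).card ≤ 2 := by
    intro i _
    by_contra hc
    push Not at hc
    obtain ⟨a, b, c, ha, hb, hc, h1, h2, h3⟩ := Finset.two_lt_card_iff.mp hc
    simp only [Finset.mem_bipartiteAbove] at ha hb hc
    exact hle i a ha.1 b hb.1 c hc.1 h1 h2 h3 ha.2 hb.2 hc.2
  have h1 : ∀ q ∈ Q, 1 ≤ (Finset.bipartiteBelow r Finset.univ q).card := by
    intro q hq
    obtain ⟨i, hi⟩ := hcov q hq
    exact Finset.card_pos.mpr ⟨i, by simp [Finset.mem_bipartiteBelow, hi]⟩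
  have s1 := Finset.sum_le_sum h1
  have s2 := Finset.sum_le_sum h2
  simp only [Finset.sum_const, Finset.card_univ, Fintype.card_fin, smul_eq_mul, mul_one] at s1 s2
  have e1 : ∑ q ∈ Q, 1 = ∑ q ∈ Q, (Finset.bipartiteBelow r Finset.univ q).card := by
    simp; omega
  have e2 : ∑ i : Fin n, (Finset.bipartiteAbove r Q i).card = ∑ i : Fin n, 2 := by
    simp; omega
  rw [Finset.sum_eq_sum_iff_of_le h1] at e1
  rw [Finset.sum_eq_sum_iff_of_le h2] at e2
  constructor
  · intro i
    obtain ⟨x, y, hxy, h⟩ := Finset.card_eq_two.mp (e2 i (Finset.mem_univ i))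
    have hm : ∀ q, (q ∈ Q ∧ r i q) ↔ q = x ∨ q = y := by
      intro q
      have : q ∈ Finset.bipartiteAbove r Q i ↔ q ∈ ({x, y} : Finset α) := by rw [h]
      simpa [Finset.mem_bipartiteAbove] using this
    exact ⟨x, y, ((hm x).mpr (Or.inl rfl)).1, ((hm y).mpr (Or.inr rfl)).1, hxy, fun q hq => by
      rw [← hm]; simp [hq]⟩
  · intro q hq i i' hi hi'
    have := (e1 q hq).symm
    exact Finset.card_le_one.mp this.le i (by simp [Finset.mem_bipartiteBelow, hi]) i'
      (by simp [Finset.mem_bipartiteBelow, hi'])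

theorem edge_lemma {a b v u w : Pt} (h1 : orient a b v < 0) (h2 : orient a b u < 0)
    (h3 : 0 < orient a v u) (h4 : 0 < orient u b v) (h5 : 0 < orient a b w)
    (h6 : 0 < orient a v w) (h7 : 0 < orient u b w) : 0 < orient v u w := by
  have key : orient a v u * orient u b v * orient a b w
      = orient a b v * orient a b u * orient v u w + orient a b u * orient u b v * orient a v w
        + orient a b v * orient a v u * orient u b w := by unfold orient; ring
  by_contra hc
  push Not at hc
  have k1 := mul_pos (mul_pos h3 h4) h5
  have k2 := mul_pos (mul_pos (neg_pos.mpr h2) h4) h6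
  have k3 := mul_pos (mul_pos (neg_pos.mpr h1) h3) h7
  have k4 := mul_nonneg (mul_pos (neg_pos.mpr h1) (neg_pos.mpr h2)).le (neg_nonneg.mpr hc)
  nlinarith

theorem ccw_cyc {t : ℕ} (p : Fin (t + 1) → Pt)
    (h : ∀ a b c : Fin (t + 1), a < b → b < c → 0 < orient (p a) (p b) (p c)) (i l : Fin (t + 1)) :
    0 ≤ orient (p i) (p (i + 1)) (p l) := by
  by_cases hl : l = i
  · subst hl; rw [o_self1]
  by_cases hl' : l = i + 1
  · subst hl'; rw [o_self2]
  by_cases hi : i = Fin.last t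
  · subst hi
    rw [Fin.last_add_one] at hl' ⊢
    rw [o_cyc]
    exact (h _ _ _ (Fin.pos_of_ne_zero hl') (Fin.lt_last_iff_ne_last.mpr hl)).le
  · have hv : (i + 1).val = i.val + 1 := Fin.val_add_one_of_lt (Fin.lt_last_iff_ne_last.mpr hi)
    have hn : l.val ≠ i.val := fun h => hl (Fin.ext h)
    have hn' : l.val ≠ i.val + 1 := fun h => hl' (Fin.ext (by rw [hv, h]))
    rcases lt_or_gt_of_ne hn with h' | h'
    · rw [o_cyc2]
      exact (h l i (i + 1) h' (by rw [Fin.lt_def, hv]; omega)).le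
    · exact (h i (i + 1) l (by rw [Fin.lt_def, hv]; omega) (by rw [Fin.lt_def, hv]; omega)).le

theorem core {Z Y Q P : Set Pt} (hZ : Z.Finite) (hg : GenPos Z) (hQ : Q = extremePts Z)
    (hY : Y = peel Z) (hP : P = extremePts Y)
    (htri : ∀ a ∈ Q, ∀ b ∈ Q, ∀ c ∈ Q, a ≠ b → a ≠ c → b ≠ c →
        ∃! p : Pt, p ∈ Y ∩ interior (convexHull ℝ ({a, b, c} : Set Pt)))
    (t : ℕ) (ht : 1 ≤ t) (hcard : Q.ncard = 2 * (t + 1))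
    (p : Fin (t + 1) → Pt) (hp : CCWEnum P p) :
    ∃ q : Fin (2 * t + 2) → Pt, CCWEnum Q q ∧
      ∀ i : Fin (t + 1),
        AdoptablePair Q (p i)
          (q ⟨2 * i.val, by have := i.isLt; omega⟩)
          (q ⟨2 * i.val + 1, by have := i.isLt; omega⟩) := by
  classical
  obtain ⟨hpi, hpr, hpc⟩ := hp
  have hQZ : Q ⊆ Z := by rw [hQ]; exact extremePoints_convexHull_subset
  have hYZ : Y ⊆ Z := by rw [hY]; exact fun x hx => hx.1
  have hPY : P ⊆ Y := by rw [hP]; exact extremePoints_convexHull_subset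
  have hQY : ∀ q ∈ Q, ∀ y ∈ Y, q ≠ y := by
    rintro q hq y hy rfl
    rw [hY] at hy; rw [hQ] at hq
    exact hy.2 hq
  have hpY : ∀ i, p i ∈ Y := fun i => hPY (by rw [← hpr]; exact ⟨i, rfl⟩)
  have hYhull : Y ⊆ convexHull ℝ P := by
    rw [hP, hull_extremePts (hZ.subset hYZ)]; exact subset_convexHull ℝ Y
  have hQhull : Y ⊆ convexHull ℝ Q := by
    rw [hQ, hull_extremePts hZ]; exact hYZ.trans (subset_convexHull ℝ Z)
  have hne1 : ∀ i : Fin (t + 1), i ≠ i + 1 := by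
    intro i h
    have : (1 : Fin (t + 1)) = 0 := by simpa using h.symm
    rw [Fin.one_eq_zero_iff] at this
    omega
  have hpne : ∀ i, p i ≠ p (i + 1) := fun i h => hne1 i (hpi h)
  have F1 : ∀ i, ∀ y ∈ Y, 0 ≤ orient (p i) (p (i + 1)) y := by
    intro i y hy
    refine hull_nonneg ?_ (hYhull hy)
    rw [← hpr]
    rintro _ ⟨l, rfl⟩
    exact ccw_cyc p hpc i l
  have hgq : ∀ i l, i ≠ l → ∀ q ∈ Q, orient (p i) (p l) q ≠ 0 := fun i l hil q hq =>
    hg _ (hYZ (hpY _)) _ (hYZ (hpY _)) _ (hQZ hq) (fun h => hil (hpi h)) (hQY q hq _ (hpY _)).symm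
      (hQY q hq _ (hpY _)).symm
  have F2 : ∀ q ∈ Q, ∃ i, orient (p i) (p (i + 1)) q < 0 := by
    intro q hq
    by_contra hc
    push Not at hc
    have hc' : ∀ i, 0 < orient (p i) (p (i + 1)) q := fun i =>
      lt_of_le_of_ne (hc i) (hgq i _ (hne1 i) q hq).symm
    have key : ∀ l : ℕ, 1 ≤ l → ∀ hl : l < t + 1, 0 < orient (p 0) (p ⟨l, hl⟩) q := by
      intro l hl1
      induction l, hl1 using Nat.le_induction with
      | base =>
        intro hl
        have := hc' 0
        have e : (0 : Fin (t + 1)) + 1 = ⟨1, hl⟩ := by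
          ext
          rw [Fin.val_add_one_of_lt (by rw [Fin.lt_def]; simp; omega)]
          simp
        rwa [e] at this
      | succ l hl1 ih =>
        intro hl
        have a1 := ih (by omega)
        have a2 := hc' ⟨l, by omega⟩
        have e : (⟨l, by omega⟩ : Fin (t + 1)) + 1 = ⟨l + 1, hl⟩ := by
          ext
          rw [Fin.val_add_one_of_lt (by rw [Fin.lt_def]; simp; omega)]
        rw [e] at a2
        by_contra hcon
        have hcon := lt_of_le_of_ne (not_lt.mp hcon)
          (hgq 0 ⟨l + 1, hl⟩ (by intro h; have := congrArg Fin.val h; simp at this) q hq)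
        have a3 : 0 < orient (p ⟨l + 1, hl⟩) (p 0) q := by
          have : orient (p ⟨l + 1, hl⟩) (p 0) q = - orient (p 0) (p ⟨l + 1, hl⟩) q := by
            unfold orient; ring
          linarith
        have hm := mem_tri a1 a2 a3
        rw [hQ] at hq
        have := extreme_tri hq (S := {p 0, p ⟨l, by omega⟩, p ⟨l + 1, hl⟩}) (by
          rintro z (rfl | rfl | rfl) <;> exact subset_convexHull ℝ _ (hYZ (hpY _))) hm
        rw [← hQ] at hq
        rcases this with h | h | h <;> exact hQY q hq _ (hpY _) h
    have a1 := key t ht (by omega)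
    have a2 := hc' (Fin.last t)
    rw [Fin.last_add_one] at a2
    have : orient (p (Fin.last t)) (p 0) q = - orient (p 0) (p ⟨t, by omega⟩) q := by
      unfold orient Fin.last; ring
    linarith
  have htri' : ∀ a ∈ Q, ∀ b ∈ Q, ∀ c ∈ Q, a ≠ b → a ≠ c → b ≠ c →
      ∃ y ∈ Y, y ∈ convexHull ℝ ({a, b, c} : Set Pt) := by
    intro a ha b hb c hc h1 h2 h3
    obtain ⟨y, hy, -⟩ := htri a ha b hb c hc h1 h2 h3
    exact ⟨y, hy.1, interior_subset hy.2⟩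
  have hQf : Q.Finite := hZ.subset hQZ
  have F3 := count_lemma (n := t + 1) hQf.toFinset
    (by rw [← hcard, Set.ncard_eq_toFinset_card Q hQf])
    (fun i q => orient (p i) (p (i + 1)) q < 0) (by simpa using F2) (by
      intro i a ha b hb c hc h1 h2 h3 ra rb rc
      simp only [Set.Finite.mem_toFinset] at ha hb hc
      obtain ⟨y, hy, hyt⟩ := htri' a ha b hb c hc h1 h2 h3
      have e : ∀ s, orient (p (i + 1)) (p i) s = - orient (p i) (p (i + 1)) s := fun s => by
        unfold orient; ring
      have := hull_pos (a := p (i + 1)) (b := p i) (S := {a, b, c})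
        (by rintro s (rfl | rfl | rfl) <;> rw [e] <;> linarith) hyt
      rw [e] at this
      linarith [F1 i y hy])
  simp only [Set.Finite.mem_toFinset] at F3
  obtain ⟨F3a, F3b⟩ := F3
  have F4 : ∀ i : Fin (t + 1), ∃ u v, u ∈ Q ∧ v ∈ Q ∧ orient (p (i - 1)) (p i) u < 0 ∧
      orient (p i) (p (i + 1)) v < 0 ∧ 0 < orient u v (p i) ∧
      ∀ q ∈ Q, q ≠ u → q ≠ v → 0 < orient u (p i) q ∧ 0 < orient (p i) v q := by
    intro i
    have f1 := F1 (i - 1)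
    have f3 := F3a (i - 1)
    have fn := hpne (i - 1)
    have fd := hne1 (i - 1)
    rw [sub_add_cancel] at f1 f3 fn fd
    refine corner_exists hg hYZ hQZ hQY (hpY i) (hpY (i - 1)) (hpY (i + 1)) fn.symm (hpne i) f1
      (F1 i) f3 (F3a i) (fun q hq h1 h2 => ?_) htri' (hQhull (hpY i))
    exact fd (F3b q hq (i - 1) i (by simpa using h1) h2)
  choose u v hu hv hu1 hv1 huvp hrest using F4
  have hu1' : ∀ i, orient (p i) (p (i + 1)) (u (i + 1)) < 0 := by
    intro i
    have := hu1 (i + 1)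
    rwa [add_sub_cancel_right] at this
  have uinj : ∀ i i', u i = u i' → i = i' := by
    intro i i' h
    have a := hu1' (i - 1)
    have b := hu1' (i' - 1)
    simp only [sub_add_cancel] at a b
    have := F3b (u i) (hu i) (i - 1) (i' - 1) (by simpa using a) (by rw [h]; simpa using b)
    simpa using this
  have vinj : ∀ i i', v i = v i' → i = i' := fun i i' h =>
    F3b (v i) (hv i) i i' (hv1 i) (by rw [h]; exact hv1 i')
  have uv0 : ∀ i i', u i = v i' → i = i' + 1 := by
    intro i i' h
    have a := hu1' (i - 1)
    simp only [sub_add_cancel] at a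
    have := F3b (u i) (hu i) (i - 1) i' (by simpa using a) (by rw [h]; exact hv1 i')
    rw [← this]; simp
  have huv : ∀ i, u i ≠ v i := fun i h => hne1 i (uv0 i i h)
  have hedge : ∀ i, ∀ q ∈ Q, q ≠ u i → q ≠ v i → 0 < orient (u i) (v i) q := by
    intro i q hq h1 h2
    obtain ⟨a, b⟩ := hrest i q hq h1 h2
    rw [o_sum (p i)]
    have e1 := o_cyc2 (u i) (v i) (p i)
    have e2 := o_cyc (u i) (p i) q
    linarith [huvp i]
  have hadopt : ∀ i, ∀ q ∈ Q, q ≠ u i → q ≠ v i →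
      p i ∈ interior (convexHull ℝ ({u i, v i, q} : Set Pt)) := by
    intro i q hq h1 h2
    obtain ⟨a, b⟩ := hrest i q hq h1 h2
    refine mem_int_tri (huvp i) ?_ ?_
    · rw [o_cyc2]; exact b
    · rw [o_cyc]; exact a
  have huv1 : ∀ i, u (i + 1) ≠ v i := by
    intro i h
    have hui : u i ≠ u (i + 1) := fun h => hne1 i (uinj _ _ h)
    by_cases hc : u i = v (i + 1)
    · -- a third point
      have : ∃ q ∈ Q, q ∉ ({u i, v i} : Set Pt) := by
        have := Set.ncard_pair (huv i)
        exact Set.exists_mem_notMem_of_ncard_lt_ncard (by omega) (by simp)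
      obtain ⟨q, hq, hqn⟩ := this
      simp only [mem_insert_iff, mem_singleton_iff, not_or] at hqn
      have a := hedge i q hq hqn.1 hqn.2
      have b := hedge (i + 1) q hq (by rw [h]; exact hqn.2) (by rw [← hc]; exact hqn.1)
      rw [h, ← hc] at b
      have : orient (v i) (u i) q = - orient (u i) (v i) q := by unfold orient; ring
      linarith
    · have hvv : v (i + 1) ≠ v i := fun h => hne1 i (vinj _ _ h).symm
      obtain ⟨y, -, hy⟩ := htri (u i) (hu i) (v i) (hv i) (v (i + 1)) (hv (i + 1)) (huv i) hc hvv.symm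
      have a := hadopt i (v (i + 1)) (hv _) (fun h => hc h.symm) hvv
      have b := hadopt (i + 1) (u i) (hu _) hui hc
      rw [h] at b
      have e : ({v i, v (i + 1), u i} : Set Pt) = {u i, v i, v (i + 1)} := by
        ext s; simp only [mem_insert_iff, mem_singleton_iff]; tauto
      rw [e] at b
      exact hpne i ((hy _ ⟨hpY _, a⟩).trans (hy _ ⟨hpY _, b⟩).symm)
  have uvne : ∀ i i', u i ≠ v i' := by
    intro i i' h
    have := uv0 i i' h
    subst this
    exact huv1 i' h
  have hedge2 : ∀ i, ∀ q ∈ Q, q ≠ v i → q ≠ u (i + 1) → 0 < orient (v i) (u (i + 1)) q := by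
    intro i q hq h1 h2
    have hui : u (i + 1) ≠ u i := fun h => hne1 i (uinj _ _ h).symm
    have hvv : v i ≠ v (i + 1) := fun h => hne1 i (vinj _ _ h)
    by_cases h3 : q = u i
    · subst h3
      rw [o_cyc2]
      exact hedge i _ (hu _) hui (huv1 i)
    by_cases h4 : q = v (i + 1)
    · subst h4
      rw [o_cyc]
      exact hedge (i + 1) _ (hv _) (uvne _ _).symm hvv
    have hpos : 0 < orient (p i) (p (i + 1)) q := by
      refine lt_of_le_of_ne ?_ (hgq i _ (hne1 i) q hq).symm
      by_contra hneg
      push Not at hneg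
      obtain ⟨x, y, hx, hy, hxy, hh⟩ := F3a i
      have c1 := (hh _ hq).mp hneg
      have c2 := (hh _ (hv i)).mp (hv1 i)
      have c3 := (hh _ (hu (i + 1))).mp (hu1' i)
      have c4 := huv1 i
      grind
    exact edge_lemma (hv1 i) (hu1' i) (hrest i _ (hu _) hui (huv1 i)).2
      (hrest (i + 1) _ (hv _) (uvne _ _).symm hvv).1 hpos (hrest i _ hq h3 h1).2
      (hrest (i + 1) _ hq h2 h4).1
  -- the enumeration
  let q : Fin (2 * t + 2) → Pt := fun s =>
    if s.val % 2 = 0 then u ⟨s.val / 2, by omega⟩ else v ⟨s.val / 2, by omega⟩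
  have q0 : ∀ (i : ℕ) (hi : i < t + 1), q ⟨2 * i, by omega⟩ = u ⟨i, hi⟩ := by
    intro i hi
    simp [q]
  have q1 : ∀ (i : ℕ) (hi : i < t + 1), q ⟨2 * i + 1, by omega⟩ = v ⟨i, hi⟩ := by
    intro i hi
    have e1 : (2 * i + 1) % 2 = 1 := by omega
    have e2 : (2 * i + 1) / 2 = i := by omega
    simp [q, e1, e2]
  have qmem : ∀ s, q s ∈ Q := by
    intro s
    simp only [q]
    split_ifs
    · exact hu _
    · exact hv _
  have qinj : Function.Injective q := by
    intro s s' h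
    simp only [q] at h
    split_ifs at h with h1 h2 h2
    · have := congrArg Fin.val (uinj _ _ h); simp at this; ext; omega
    · exact absurd h (uvne _ _)
    · exact absurd h.symm (uvne _ _)
    · have := congrArg Fin.val (vinj _ _ h); simp at this; ext; omega
  have qrange : Set.range q = Q := by
    apply Set.eq_of_subset_of_ncard_le
    · rintro _ ⟨s, rfl⟩; exact qmem s
    · rw [hcard, ← Set.image_univ, Set.ncard_image_of_injective _ qinj, Set.ncard_univ]
      simp; omega
    · exact hQf
  refine ⟨q, ⟨qinj, qrange, ?_⟩, ?_⟩
  · refine ccw_of_edges hg (hQ ▸ hQZ) q qinj (fun i => hQ ▸ qmem i) ?_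
    intro s hs r hr1 hr2
    have hn1 : q r ≠ q ⟨s, by omega⟩ := fun h => hr1 (congrArg Fin.val (qinj h))
    have hn2 : q r ≠ q ⟨s + 1, hs⟩ := fun h => hr2 (congrArg Fin.val (qinj h))
    rcases Nat.even_or_odd' s with ⟨i, rfl | rfl⟩
    · rw [q0 i (by omega)] at hn1 ⊢
      rw [q1 i (by omega)] at hn2 ⊢
      exact hedge _ _ (qmem r) hn1 hn2
    · have e : (⟨2 * i + 1 + 1, hs⟩ : Fin (2 * t + 2)) = ⟨2 * (i + 1), by omega⟩ := by
        ext; simp; omega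
      have e2 : (⟨i + 1, by omega⟩ : Fin (t + 1)) = ⟨i, by omega⟩ + 1 := by
        ext
        rw [Fin.val_add_one_of_lt (by rw [Fin.lt_def]; simp; omega)]
      rw [q1 i (by omega)] at hn1 ⊢
      rw [e, q0 (i + 1) (by omega), e2] at hn2 ⊢
      exact hedge2 _ _ (qmem r) hn1 hn2
  · intro i q3 hq3
    rw [q0 i.val i.isLt, q1 i.val i.isLt] at hq3 ⊢
    simp only [mem_sdiff, mem_insert_iff, mem_singleton_iff, not_or] at hq3
    exact hadopt i q3 hq3.1 hq3.2.1 hq3.2.2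

theorem peel_iter_sub (X : Set Pt) (n : ℕ) : peel^[n] X ⊆ X := by
  induction n with
  | zero => exact subset_rfl
  | succ n ih =>
    rw [Function.iterate_succ_apply']
    exact fun x hx => ih hx.1

/-- (Lemma 2.) If `p_0, …, p_t` is a counterclockwise enumeration of `R_j`,
then `R_{j+1}` admits a counterclockwise enumeration `q_0, …, q_{2t+1}` such that
`(q_{2i}, q_{2i+1})` is adoptable from `p_i` for all `i`. -/
theorem nacs_adoptable_enum (X : Set Pt) (hX : IsNACS X) (k : ℕ) (hk : HasLayers X k)
    (j : ℕ) (hj1 : 1 ≤ j) (hjk : j + 1 ≤ k)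
    (h2 : 2 ≤ (layer X k j).ncard)
    (hdouble : (layer X k (j + 1)).ncard = 2 * (layer X k j).ncard)
    (t : ℕ) (ht : t + 1 = (layer X k j).ncard)
    (p : Fin (t + 1) → Pt) (hp : CCWEnum (layer X k j) p) :
    ∃ q : Fin (2 * t + 2) → Pt, CCWEnum (layer X k (j + 1)) q ∧
      ∀ i : Fin (t + 1),
        AdoptablePair (layer X k (j + 1)) (p i)
          (q ⟨2 * i.val, by have := i.isLt; omega⟩)
          (q ⟨2 * i.val + 1, by have := i.isLt; omega⟩) := by
  obtain ⟨hf, -, hg, htri⟩ := hX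
  have hsub : layerSub X k (j + 1) ⊆ X := peel_iter_sub X _
  have hY : layerSub X k j = peel (layerSub X k (j + 1)) := by
    unfold layerSub
    rw [← Function.iterate_succ_apply' peel]
    congr 2
    omega
  refine core (hf.subset hsub) (fun a ha b hb c hc => hg a (hsub ha) b (hsub hb) c (hsub hc))
    rfl hY rfl ?_ t (by omega) (hdouble.trans (by omega)) p hp
  have := htri k hk (j + 1) (by omega) hjk
  rwa [Nat.add_sub_cancel] at this
end
end

section
/- (Theorem 2, (1) ⇒ (2)) Let X be a nested almost convex set. Then there exists an integer k ≥ 1 and a labeling ψ of X (a type-1 labeling into T₁(k) or a type-2 labeling into T₂(k)) that is nested, adoptable and well laid. -/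
open Set

noncomputable section

/-! ### Orientation algebra -/

def InTri (a b c p : Pt) : Prop := 0 < orient a b p ∧ 0 < orient b c p ∧ 0 < orient c a p

lemma orient_cyc (a b c : Pt) : orient b c a = orient a b c := by
  unfold orient; ring

lemma orient_swap (a b c : Pt) : orient b a c = - orient a b c := by
  unfold orient; ring

lemma orient_swap' (a b c : Pt) : orient a c b = - orient a b c := by
  unfold orient; ring

lemma orient_self (a c : Pt) : orient a a c = 0 := by
  unfold orient; ring

lemma orient_self' (a c : Pt) : orient a c a = 0 := by
  unfold orient; ring

lemma orient_self'' (a c : Pt) : orient a c c = 0 := by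
  unfold orient; ring

lemma inTri_rot {a b c p : Pt} (h : InTri a b c p) : InTri b c a p := ⟨h.2.1, h.2.2, h.1⟩

lemma orient_split (a b c p : Pt) :
    orient a b c = orient a b p + orient b c p + orient c a p := by
  unfold orient; ring

lemma plucker (a u v w x : Pt) :
    orient a u v * orient a w x - orient a u w * orient a v x + orient a u x * orient a v w = 0 := by
  unfold orient; ring

lemma inTri_bary {a b c p : Pt} (h : InTri a b c p) :
    ∃ α β γ : ℝ, 0 < α ∧ 0 < β ∧ 0 < γ ∧ α + β + γ = 1 ∧
      p.1 = α * a.1 + β * b.1 + γ * c.1 ∧ p.2 = α * a.2 + β * b.2 + γ * c.2 := by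
  obtain ⟨h1, h2, h3⟩ := h
  have hs := orient_split a b c p
  have hpos : 0 < orient a b c := by linarith
  refine ⟨orient b c p / orient a b c, orient c a p / orient a b c, orient a b p / orient a b c,
    by positivity, by positivity, by positivity, ?_, ?_, ?_⟩
  · field_simp; linarith
  · field_simp; unfold orient; ring
  · field_simp; unfold orient; ring

lemma orient_comb {a b c p : Pt} {α β γ : ℝ} (hs : α + β + γ = 1)
    (h1 : p.1 = α * a.1 + β * b.1 + γ * c.1) (h2 : p.2 = α * a.2 + β * b.2 + γ * c.2) (y z : Pt) :
    orient p y z = α * orient a y z + β * orient b y z + γ * orient c y z := by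
  unfold orient
  linear_combination (-(z.2 - y.2)) * h1 + (z.1 - y.1) * h2 - (y.1 * z.2 - y.2 * z.1) * hs

/-- positivity transfers to interior points of a triangle -/
lemma orient_pos_of_inTri {a b c p y z : Pt} (h : InTri a b c p) (ha : 0 ≤ orient a y z)
    (hb : 0 ≤ orient b y z) (hc : 0 ≤ orient c y z)
    (hh : 0 < orient a y z ∨ 0 < orient b y z ∨ 0 < orient c y z) : 0 < orient p y z := by
  obtain ⟨α, β, γ, h1, h2, h3, hs, hx, hy⟩ := inTri_bary h
  rw [orient_comb hs hx hy]
  have i1 := mul_nonneg h1.le ha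
  have i2 := mul_nonneg h2.le hb
  have i3 := mul_nonneg h3.le hc
  rcases hh with hh | hh | hh
  · have := mul_pos h1 hh; linarith
  · have := mul_pos h2 hh; linarith
  · have := mul_pos h3 hh; linarith

lemma quad {A B C D y y' : Pt} (h1 : InTri A B C y) (h2 : InTri A B D y)
    (h3 : InTri C D A y') (h4 : InTri C D B y') : InTri C D y y' := by
  refine ⟨h3.1, ?_, ?_⟩
  · rw [← orient_cyc]
    refine orient_pos_of_inTri h2 ?_ ?_ ?_ ?_
    · rw [orient_cyc]; exact h3.2.1.le
    · rw [orient_cyc]; exact h4.2.1.le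
    · rw [orient_self']
    · left; rw [orient_cyc]; exact h3.2.1
  · refine orient_pos_of_inTri h1 h3.2.2.le h4.2.2.le ?_ (Or.inl h3.2.2)
    rw [orient_self]

lemma transfer_pos {A B C D y y' p : Pt} (h1 : InTri A B C y) (h2 : InTri A B D y)
    (h3 : InTri C D A y') (h4 : InTri C D B y') (hAC : 0 < orient A C p) (hAD : 0 < orient A D p)
    (hBC : 0 < orient B C p) (hBD : 0 < orient B D p) : 0 < orient y y' p := by
  have hC : 0 < orient y C p :=
    orient_pos_of_inTri h1 hAC.le hBC.le (by rw [orient_self]) (Or.inl hAC)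
  have hD : 0 < orient y D p :=
    orient_pos_of_inTri h2 hAD.le hBD.le (by rw [orient_self]) (Or.inl hAD)
  have hq := quad h1 h2 h3 h4
  rw [← orient_cyc]
  refine orient_pos_of_inTri hq ?_ ?_ ?_ ?_
  · rw [orient_cyc]; exact hC.le
  · rw [orient_cyc]; exact hD.le
  · rw [orient_self']
  · left; rw [orient_cyc]; exact hC

lemma transfer_neg {A B C D y y' p : Pt} (h1 : InTri A B C y) (h2 : InTri A B D y)
    (h3 : InTri C D A y') (h4 : InTri C D B y') (hAC : orient A C p < 0) (hAD : orient A D p < 0)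
    (hBC : orient B C p < 0) (hBD : orient B D p < 0) : orient y y' p < 0 := by
  have key : ∀ u v w : Pt, orient u v w < 0 ↔ 0 < orient v u w := by
    intro u v w; rw [orient_swap u v w]; constructor <;> intro h <;> linarith
  rw [key] at *
  exact transfer_pos h3 h4 h1 h2 hAC hBC hAD hBD

/-! ### Triangles and convex hulls -/

lemma mem_hull_of_inTri {a b c p : Pt} (h : InTri a b c p) :
    p ∈ convexHull ℝ ({a, b, c} : Set Pt) := by
  obtain ⟨α, β, γ, h1, h2, h3, hs, hx, hy⟩ := inTri_bary h
  have hp : p = ∑ i : Fin 3, (![α, β, γ] i) • (![a, b, c] i) := by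
    simp only [Fin.sum_univ_three]
    ext
    · simpa using hx
    · simpa using hy
  rw [hp]
  refine (convex_convexHull ℝ _).sum_mem ?_ ?_ ?_
  · intro i _; fin_cases i <;> simp <;> linarith
  · simp [Fin.sum_univ_three, hs]
  · intro i _; apply subset_convexHull; fin_cases i <;> simp

lemma continuous_orient (a b : Pt) : Continuous fun p => orient a b p := by
  unfold orient; fun_prop

lemma mem_interior_of_inTri {a b c p : Pt} (h : InTri a b c p) :
    p ∈ interior (convexHull ℝ ({a, b, c} : Set Pt)) := by
  have ho : IsOpen {x : Pt | InTri a b c x} := by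
    have : {x : Pt | InTri a b c x} =
      {x | 0 < orient a b x} ∩ ({x | 0 < orient b c x} ∩ {x | 0 < orient c a x}) := rfl
    rw [this]
    exact (isOpen_lt continuous_const (continuous_orient a b)).inter
      ((isOpen_lt continuous_const (continuous_orient b c)).inter
        (isOpen_lt continuous_const (continuous_orient c a)))
  exact interior_maximal (fun x hx => mem_hull_of_inTri hx) ho h

lemma orient_nonneg_of_hull {S : Set Pt} {a b p : Pt} (hp : p ∈ convexHull ℝ S)
    (h : ∀ s ∈ S, 0 ≤ orient a b s) : 0 ≤ orient a b p := by
  have hc : Convex ℝ {x : Pt | 0 ≤ orient a b x} := by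
    intro x hx y hy α β hα hβ hαβ
    have : orient a b (α • x + β • y) = α * orient a b x + β * orient a b y := by
      unfold orient
      simp only [Prod.fst_add, Prod.snd_add, Prod.smul_fst, Prod.smul_snd, smul_eq_mul]
      linear_combination ((b.1 - a.1) * a.2 - (b.2 - a.2) * a.1) * hαβ
    simp only [Set.mem_ofPred_eq] at *
    rw [this]; positivity
  exact convexHull_min (t := {x : Pt | 0 ≤ orient a b x}) h hc hp

/-! ### Extreme points of finite sets -/

lemma extremePts_subset (S : Set Pt) : extremePts S ⊆ S := extremePoints_convexHull_subset

lemma hull_extremePts_s7 {S : Set Pt} (hS : S.Finite) :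
    convexHull ℝ (extremePts S) = convexHull ℝ S := by
  have h := closure_convexHull_extremePoints (hS.isCompact_convexHull (𝕜 := ℝ)) (convex_convexHull ℝ S)
  have hf : (extremePts S).Finite := hS.subset (extremePts_subset S)
  rw [← h]
  exact (hf.isClosed_convexHull (𝕜 := ℝ)).closure_eq.symm

lemma extremePts_nonempty {S : Set Pt} (hS : S.Finite) (hn : S.Nonempty) :
    (extremePts S).Nonempty :=
  (hS.isCompact_convexHull (𝕜 := ℝ)).extremePoints_nonempty (convexHull_nonempty_iff.2 hn)

lemma mem_extremePts_of_sep {S : Set Pt} (hS : S.Finite) {p a b : Pt} (hp : p ∈ S)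
    (hneg : orient a b p < 0) (h : ∀ x ∈ S, x ≠ p → 0 ≤ orient a b x) : p ∈ extremePts S := by
  by_contra hne
  have h1 : p ∈ convexHull ℝ (extremePts S) := by
    rw [hull_extremePts_s7 hS]; exact subset_convexHull _ _ hp
  have := orient_nonneg_of_hull (a := a) (b := b) h1 (fun s hs =>
    h s (extremePts_subset S hs) (fun hh => hne (hh ▸ hs)))
  linarith

lemma not_inTri_extremePts {S : Set Pt} {a b c p : Pt} (ha : a ∈ S) (hb : b ∈ S) (hc : c ∈ S)
    (hp : p ∈ extremePts S) : ¬ InTri a b c p := by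
  intro h
  have hne : ∀ x y, 0 < orient x y p → p ≠ x ∧ p ≠ y := by
    intro x y hxy
    constructor
    · rintro rfl; rw [orient_self'] at hxy; exact lt_irrefl _ hxy
    · rintro rfl; rw [orient_self''] at hxy; exact lt_irrefl _ hxy
  have hcv := ((convex_convexHull ℝ S).mem_extremePoints_iff_convex_sdiff.1 hp).2
  have hsub : ({a, b, c} : Set Pt) ⊆ convexHull ℝ S \ {p} := by
    rintro x (rfl | rfl | rfl)
    · exact ⟨subset_convexHull _ _ ha, fun hh => (hne _ _ h.1).1 hh.symm⟩
    · exact ⟨subset_convexHull _ _ hb, fun hh => (hne _ _ h.1).2 hh.symm⟩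
    · exact ⟨subset_convexHull _ _ hc, fun hh => (hne _ _ h.2.1).2 hh.symm⟩
  exact (convexHull_min hsub hcv (mem_hull_of_inTri h)).2 rfl

/-! ### Cyclic enumerations -/

/-- `q` is an `m`-periodic counterclockwise enumeration of `S`. -/
structure Cyc (m : ℕ) (q : ℤ → Pt) (S : Set Pt) : Prop where
  per : ∀ i : ℤ, q (i + m) = q i
  inj : ∀ a b : ℤ, a < b → b < a + m → q a ≠ q b
  pos : ∀ a b c : ℤ, a < b → b < c → c < a + m → 0 < orient (q a) (q b) (q c)
  rng : Set.range q = S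

/-- `P` is an almost convex interior of the polygon `q`. -/
structure AC (m : ℕ) (q : ℤ → Pt) (P : Set Pt) : Prop where
  per : ∀ i : ℤ, q (i + m) = q i
  pos : ∀ a b c : ℤ, a < b → b < c → c < a + m → 0 < orient (q a) (q b) (q c)
  left : ∀ p ∈ P, ∀ i, 0 < orient (q i) (q (i + 1)) p
  gp : ∀ p ∈ P, ∀ i j : ℤ, i < j → j < i + m → orient (q i) (q j) p ≠ 0
  uniq : ∀ a b c : ℤ, a < b → b < c → c < a + m → ∃ p ∈ P, InTri (q a) (q b) (q c) p ∧
    ∀ p' ∈ P, InTri (q a) (q b) (q c) p' → p' = p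

lemma per_mul {m : ℕ} {q : ℤ → Pt} (h : ∀ i, q (i + m) = q i) (i t : ℤ) : q (i + t * m) = q i := by
  induction t using Int.induction_on with
  | zero => simp
  | succ t ih => rw [← ih, ← h (i + t * m)]; congr 1; ring
  | pred t ih => rw [← ih, ← h (i + (-(t : ℤ) - 1) * m)]; congr 1; ring

lemma per_emod {m : ℕ} {q : ℤ → Pt} (h : ∀ i, q (i + m) = q i) (i : ℤ) : q (i % m) = q i := by
  rw [← per_mul h (i % m) (i / m)]; congr 1
  have := Int.emod_add_mul_ediv i m
  linarith [mul_comm (m : ℤ) (i / m)]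

lemma ncard_range {m : ℕ} (hm : 0 < m) {q : ℤ → Pt} (h : ∀ i, q (i + m) = q i)
    (hinj : ∀ a b : ℤ, a < b → b < a + m → q a ≠ q b) : (Set.range q).ncard = m := by
  have hr : Set.range q = q '' ((Finset.Ico (0 : ℤ) m : Finset ℤ) : Set ℤ) := by
    ext x; constructor
    · rintro ⟨i, rfl⟩
      refine ⟨i % m, ?_, per_emod h i⟩
      have h1 := Int.emod_nonneg i (b := (m : ℤ)) (by omega)
      have h2 := Int.emod_lt_of_pos i (b := (m : ℤ)) (by omega)
      simp; omega
    · rintro ⟨i, _, rfl⟩; exact ⟨i, rfl⟩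
  rw [hr, Set.InjOn.ncard_image, Set.ncard_coe_finset]
  · simp
  · intro a ha b hb hab
    simp only [Finset.coe_Ico, Set.mem_Ico] at ha hb
    by_contra hne
    rcases lt_or_gt_of_ne hne with hlt | hlt
    · exact hinj a b hlt (by omega) hab
    · exact hinj b a hlt (by omega) hab.symm

lemma Cyc.shift {m : ℕ} {q : ℤ → Pt} {S : Set Pt} (h : Cyc m q S) (t : ℤ) :
    Cyc m (fun i => q (i + t)) S where
  per i := by rw [← h.per (i + t)]; congr 1; ring
  inj a b h1 h2 := h.inj _ _ (by omega) (by omega)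
  pos a b c h1 h2 h3 := h.pos _ _ _ (by omega) (by omega) (by omega)
  rng := by
    rw [← h.rng]; ext x; constructor
    · rintro ⟨i, rfl⟩; exact ⟨_, rfl⟩
    · rintro ⟨i, rfl⟩; exact ⟨i - t, by simp⟩

lemma Cyc.mem {m : ℕ} {q : ℤ → Pt} {S : Set Pt} (h : Cyc m q S) (i : ℤ) : q i ∈ S :=
  h.rng ▸ ⟨i, rfl⟩

lemma Cyc.exists_eq {m : ℕ} {q : ℤ → Pt} {S : Set Pt} (h : Cyc m q S) (hm : 0 < m) {x : Pt}
    (hx : x ∈ S) (a : ℤ) : ∃ i, a ≤ i ∧ i < a + m ∧ q i = x := by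
  rw [← h.rng] at hx
  obtain ⟨j, rfl⟩ := hx
  refine ⟨a + (j - a) % m, ?_, ?_, ?_⟩
  · have h1 := Int.emod_nonneg (j - a) (b := (m : ℤ)) (by omega)
    omega
  · have h2 := Int.emod_lt_of_pos (j - a) (b := (m : ℤ)) (by omega)
    omega
  · have := per_emod (q := fun i => q (i + a)) (h.shift a).per (j - a)
    simp only [sub_add_cancel] at this
    rw [← this]; congr 1; ring

/-- successor characterization -/
lemma Cyc.succ_pos {m : ℕ} {q : ℤ → Pt} {S : Set Pt} (h : Cyc m q S) (hm : 0 < m) {x : Pt}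
    (hx : x ∈ S) (a : ℤ) (h0 : x ≠ q a) (h1 : x ≠ q (a + 1)) : 0 < orient (q a) (q (a + 1)) x := by
  obtain ⟨i, hi, hi', rfl⟩ := h.exists_eq hm hx a
  have : i ≠ a := by rintro rfl; exact h0 rfl
  have : i ≠ a + 1 := by rintro rfl; exact h1 rfl
  exact h.pos _ _ _ (by omega) (by omega) (by omega)

lemma Cyc.unique {m : ℕ} {p y : ℤ → Pt} {S : Set Pt} (hp : Cyc m p S) (hy : Cyc m y S)
    (hm : 2 ≤ m) : ∃ s, ∀ v, p v = y (v + s) := by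
  obtain ⟨s, -, -, hs⟩ := hy.exists_eq (by omega) (hp.mem 0) 0
  refine ⟨s, fun v => ?_⟩
  induction v using Int.induction_on with
  | zero => simp [hs]
  | succ v ih =>
    by_contra hne
    have e : (v : ℤ) + 1 + s = v + s + 1 := by ring
    rw [e] at hne
    have h1 := hp.succ_pos (by omega) (hy.mem (v + s + 1)) v
      (by rw [ih]; exact (hy.inj _ _ (by omega) (by omega)).symm) (Ne.symm hne)
    have h2 := hy.succ_pos (by omega) (hp.mem (v + 1)) (v + s)
      (by rw [← ih]; exact (hp.inj _ _ (by omega) (by omega)).symm) hne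
    rw [← ih, orient_swap'] at h2
    linarith
  | pred v ih =>
    by_contra hne
    have e1 : -(v : ℤ) - 1 + 1 = -v := by ring
    have e2 : -(v : ℤ) - 1 + s + 1 = -v + s := by ring
    have h1 := hp.succ_pos (by omega) (hy.mem (-(v : ℤ) - 1 + s)) (-v - 1) (Ne.symm hne)
      (by rw [e1, ih]; exact hy.inj _ _ (by omega) (by omega))
    have h2 := hy.succ_pos (by omega) (hp.mem (-(v : ℤ) - 1)) (-v - 1 + s) hne
      (by rw [e2, ← ih]; exact hp.inj _ _ (by omega) (by omega))
    rw [e1] at h1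
    rw [e2, ← ih, ← orient_cyc, orient_swap', ← orient_cyc, orient_cyc] at h2
    rw [← orient_cyc] at h1
    have := orient_swap (p (-(v : ℤ) - 1)) (y (-(v : ℤ) - 1 + s)) (p (-v))
    unfold orient at *
    linarith

namespace AC

variable {m : ℕ} {q : ℤ → Pt} {P : Set Pt}

lemma flip (h : AC m q P) (r s : ℤ) (p : Pt) :
    orient (q s) (q (r + m)) p = - orient (q r) (q s) p := by
  rw [h.per, orient_swap]

lemma mono1 (h : AC m q P) {p : Pt} (hp : p ∈ P) {a r s : ℤ} (h1 : a < r) (h2 : r ≤ s)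
    (h3 : s < a + m) (hs : 0 < orient (q a) (q s) p) : 0 < orient (q a) (q r) p := by
  rcases eq_or_lt_of_le h2 with rfl | h2
  · exact hs
  have hl := h.left p hp a
  rcases eq_or_lt_of_le (show a + 1 ≤ r by omega) with rfl | h4
  · exact hl
  have e := plucker (q a) (q (a + 1)) (q r) (q s) p
  have i1 := h.pos a (a + 1) r (by omega) h4 (by omega)
  have i2 := h.pos a (a + 1) s (by omega) (by omega) (by omega)
  have i3 := h.pos a r s (by omega) (by omega) (by omega)
  have j1 := mul_pos i1 hs
  have j2 := mul_pos hl i3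
  have : 0 < orient (q a) (q (a + 1)) (q s) * orient (q a) (q r) p := by linarith
  exact (mul_pos_iff_of_pos_left i2).1 this

lemma mono2 (h : AC m q P) {p : Pt} (hp : p ∈ P) {r r' s : ℤ} (h1 : r ≤ r') (h2 : r' < s)
    (h3 : s < r + m) (hs : 0 < orient (q r) (q s) p) : 0 < orient (q r') (q s) p := by
  by_contra hneg
  have hne := h.gp p hp r' s (by omega) (by omega)
  have hlt : orient (q r') (q s) p < 0 := lt_of_le_of_ne (not_lt.1 hneg) hne
  have f1 := h.flip r' s p
  have f2 := h.flip r s p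
  have := h.mono1 hp (a := s) (r := r + m) (s := r' + m) (by omega) (by omega) (by omega)
    (by linarith)
  linarith

lemma shrink (h : AC m q P) {p : Pt} (hp : p ∈ P) {r s r' s' : ℤ} (h1 : r ≤ r') (h2 : r' < s')
    (h3 : s' ≤ s) (h4 : s < r + m) (hs : 0 < orient (q r) (q s) p) :
    0 < orient (q r') (q s') p :=
  h.mono2 hp h1 h2 (by omega) (h.mono1 hp (by omega) h3 h4 hs)

/-- Chords of disjoint arcs cannot both cut off the same point. -/
lemma disjoint (h : AC m q P) {p : Pt} (hp : p ∈ P) {r s r' s' : ℤ} (h0 : r < s) (h1 : s ≤ r')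
    (h2 : r' < s') (h3 : s' ≤ r + m) (ha : orient (q r) (q s) p < 0)
    (hb : orient (q r') (q s') p < 0) : False := by
  have f := h.flip r s p
  have := h.shrink hp (r := s) (s := r + m) (r' := r') (s' := s') h1 h2 h3 (by omega) (by linarith)
  linarith

lemma ncard (h : AC m q P) (hm : 3 ≤ m) : P.ncard = m - 2 := by
  have hex : ∀ r : Fin (m - 2), ∃ p, p ∈ P ∧ InTri (q 0) (q (r + 1)) (q (r + 2)) p := by
    intro r
    obtain ⟨p, hp, ht, -⟩ := h.uniq 0 (r + 1) (r + 2) (by omega) (by omega) (by omega)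
    exact ⟨p, hp, ht⟩
  choose f hf using hex
  have aux : ∀ r r' : Fin (m - 2), r < r' → f r ≠ f r' := by
    intro r r' hlt heq
    have hlt' : (r : ℕ) < r' := hlt
    have a1 := (hf r).2.2.2
    have a2 := (hf r').2.1
    rw [← heq] at a2
    have := h.mono1 (hf r).1 (a := 0) (r := r + 2) (s := r' + 1) (by omega) (by omega) (by omega) a2
    rw [orient_swap] at a1
    linarith
  have hinj : Function.Injective f := by
    intro r r' heq
    by_contra hne
    rcases lt_or_gt_of_ne hne with hl | hl
    · exact aux _ _ hl heq
    · exact aux _ _ hl heq.symm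
  have hr : Set.range f = P := by
    ext p; constructor
    · rintro ⟨r, rfl⟩; exact (hf r).1
    · intro hp
      classical
      have hlast : ¬ 0 < orient (q 0) (q ((m - 2 : ℕ) + 1 : ℤ)) p := by
        have h1 := h.left p hp (m - 1)
        have e1 : (m : ℤ) - 1 + 1 = 0 + m := by ring
        have e2 : ((m - 2 : ℕ) + 1 : ℤ) = m - 1 := by omega
        rw [e1, h.per, orient_swap] at h1
        rw [e2]; linarith
      have hE : ∃ r : ℕ, ¬ 0 < orient (q 0) (q ((r : ℤ) + 1)) p := ⟨m - 2, hlast⟩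
      have hspec := Nat.find_spec hE
      have hle : Nat.find hE ≤ m - 2 := Nat.find_min' hE hlast
      have hz : Nat.find hE ≠ 0 := by
        intro h0
        rw [h0] at hspec
        exact hspec (by simpa using h.left p hp 0)
      obtain ⟨t, ht⟩ := Nat.exists_eq_succ_of_ne_zero hz
      have hmin := Nat.find_min hE (m := t) (by omega)
      rw [ht] at hspec
      push Not at hmin
      push_cast at hspec
      refine ⟨⟨t, by omega⟩, ?_⟩
      obtain ⟨p0, hp0, -, hu⟩ := h.uniq 0 (t + 1) (t + 2) (by omega) (by omega) (by omega)
      have hneg : orient (q 0) (q ((t : ℤ) + 2)) p < 0 := by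
        have hne := h.gp p hp 0 (t + 2) (by omega) (by omega)
        have e : (t : ℤ) + 1 + 1 = t + 2 := by ring
        rw [e] at hspec
        exact lt_of_le_of_ne (not_lt.1 hspec) hne
      have e3 : p = p0 := by
        apply hu p hp
        refine ⟨hmin, ?_, ?_⟩
        · have := h.left p hp (t + 1)
          have e : (t : ℤ) + 1 + 1 = t + 2 := by ring
          rwa [e] at this
        · rw [orient_swap]; linarith
      exact (hu _ (hf _).1 (hf ⟨t, by omega⟩).2).trans e3.symm
  rw [← hr, ← Set.image_univ, Set.ncard_image_of_injective _ hinj, Set.ncard_univ]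
  simp

end AC

/-! ### Existence of counterclockwise enumerations -/

lemma lex_trans {o a b c : Pt} (ha : toLex o < toLex a) (hb : toLex o < toLex b)
    (hc : toLex o < toLex c) (hab : 0 < orient o a b) (hbc : 0 < orient o b c) :
    0 < orient o a c := by
  rw [Prod.Lex.toLex_lt_toLex] at ha hb hc
  have id1 : orient o a c * (b.1 - o.1) = orient o a b * (c.1 - o.1) + orient o b c * (a.1 - o.1) := by
    unfold orient; ring
  have ha1 : 0 ≤ a.1 - o.1 := by 
    rcases ha with h | h
    · linarith
    · linarith [h.1]
  have hb1 : 0 ≤ b.1 - o.1 := by 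
    rcases hb with h | h
    · linarith
    · linarith [h.1]
  have hc1 : 0 ≤ c.1 - o.1 := by 
    rcases hc with h | h
    · linarith
    · linarith [h.1]
  have hb2 : 0 < b.1 - o.1 := by
    rcases hb with h | h
    · linarith
    · exfalso
      have : orient o b c = - ((b.2 - o.2) * (c.1 - o.1)) := by unfold orient; rw [← h.1]; ring
      have := mul_nonneg (sub_nonneg.2 h.2.le) hc1
      linarith
  have ha2 : 0 < a.1 - o.1 := by
    rcases ha with h | h
    · linarith
    · exfalso
      have : orient o a b = - ((a.2 - o.2) * (b.1 - o.1)) := by unfold orient; rw [← h.1]; ring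
      have := mul_nonneg (sub_nonneg.2 h.2.le) hb1
      linarith
  have h1 := mul_nonneg hab.le hc1
  have h2 := mul_pos hbc ha2
  have : 0 < orient o a c * (b.1 - o.1) := by linarith
  exact (mul_pos_iff_of_pos_right hb2).1 this

/-- the points of `S` other than `o`, as a fresh type -/
structure TSub (S : Set Pt) (o : Pt) where
  val : Pt
  prop : val ∈ S ∧ val ≠ o

lemma TSub.ext' {S : Set Pt} {o : Pt} {x y : TSub S o} (h : x.1 = y.1) : x = y := by
  cases x; cases y; cases h; rfl

/-- comparison with the subtype -/
def TSub.equiv (S : Set Pt) (o : Pt) : TSub S o ≃ {x : Pt // x ∈ S ∧ x ≠ o} where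
  toFun x := ⟨x.1, x.2⟩
  invFun x := ⟨x.1, x.2⟩
  left_inv _ := rfl
  right_inv _ := rfl

lemma exists_enum {S : Set Pt} (hf : S.Finite) (hn : S.Nonempty) (hg : GenPos S)
    (hnt : ∀ a ∈ S, ∀ b ∈ S, ∀ c ∈ S, ∀ p ∈ S, ¬ InTri a b c p) :
    ∃ g : ℕ → Pt, (∀ a b, a < b → b < S.ncard → g a ≠ g b) ∧
      (∀ a b c, a < b → b < c → c < S.ncard → 0 < orient (g a) (g b) (g c)) ∧
      (∀ a, a < S.ncard → g a ∈ S) ∧ (∀ x ∈ S, ∃ a < S.ncard, g a = x) := by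
  classical
  obtain ⟨o, hoS, homin⟩ := Set.exists_min_image S (fun p => toLex p) hf hn
  let T := TSub S o
  have hlt : ∀ x : T, toLex o < toLex x.1 := fun x =>
    lt_of_le_of_ne (homin x.1 x.2.1) (fun h => x.2.2 (toLex.injective h).symm)
  let _ : LinearOrder T :=
    { le := fun x y => x = y ∨ 0 < orient o x.1 y.1
      lt := fun x y => (x = y ∨ 0 < orient o x.1 y.1) ∧ ¬ (y = x ∨ 0 < orient o y.1 x.1)
      lt_iff_le_not_ge := fun _ _ => Iff.rfl
      le_refl := fun x => Or.inl rfl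
      le_trans := by
        rintro x y z (rfl | h1) (rfl | h2)
        · exact Or.inl rfl
        · exact Or.inr h2
        · exact Or.inr h1
        · exact Or.inr (lex_trans (hlt x) (hlt y) (hlt z) h1 h2)
      le_antisymm := by
        rintro x y (rfl | h1) (h | h2)
        · rfl
        · rfl
        · exact h.symm
        · rw [orient_swap'] at h2; linarith
      le_total := by
        intro x y
        by_cases hxy : x = y
        · exact Or.inl (Or.inl hxy)
        · have hne := hg o hoS x.1 x.2.1 y.1 y.2.1 x.2.2.symm y.2.2.symm
            (fun h => hxy (TSub.ext' h))
          rcases lt_or_gt_of_ne hne with h | h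
          · right; right; rw [orient_swap']; linarith
          · left; right; exact h
      toDecidableLE := Classical.decRel _ }
  have hle : ∀ x y : T, x ≤ y ↔ x = y ∨ 0 < orient o x.1 y.1 := fun x y => Iff.rfl
  have hTf0 : Finite {x : Pt // x ∈ S ∧ x ≠ o} := (hf.subset (fun x hx => hx.1 : {x | x ∈ S ∧ x ≠ o} ⊆ S)).to_subtype
  have hTf : Finite T := Finite.of_equiv _ (TSub.equiv S o).symm
  let _ : Fintype T := Fintype.ofFinite T
  have hcard : Fintype.card T = S.ncard - 1 := by
    rw [← Nat.card_eq_fintype_card]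
    have : Nat.card T = (S \ {o}).ncard := Nat.card_congr (TSub.equiv S o)
    rw [this, Set.ncard_sdiff_singleton_of_mem hoS]
  have hpos : 0 < S.ncard := (Set.ncard_pos hf).2 hn
  let e := monoEquivOfFin T hcard
  have he : ∀ a b : Fin (S.ncard - 1), a < b → 0 < orient o (e a).1 (e b).1 := by
    intro a b hab
    have h1 : e a ≤ e b := e.monotone hab.le
    rcases (hle _ _).1 h1 with h | h
    · exact absurd (e.injective h) hab.ne
    · exact h
  let g : ℕ → Pt := fun i => if h : 1 ≤ i ∧ i < S.ncard then (e ⟨i - 1, by omega⟩).1 else o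
  have g0 : g 0 = o := by simp [g]
  have gs : ∀ i (h1 : 1 ≤ i) (h2 : i < S.ncard), g i = (e ⟨i - 1, by omega⟩).1 := by
    intro i h1 h2; simp only [g]; rw [dif_pos ⟨h1, h2⟩]
  have gS : ∀ a, g a ∈ S := by
    intro a
    simp only [g]
    split_ifs
    · exact (e _).2.1
    · exact hoS
  have go : ∀ a b, 1 ≤ a → a < b → b < S.ncard → 0 < orient o (g a) (g b) := by
    intro a b h1 h2 h3
    rw [gs a h1 (by omega), gs b (by omega) h3]
    exact he _ _ (by simp only [Fin.lt_def]; omega)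
  have ginj : ∀ a b, a < b → b < S.ncard → g a ≠ g b := by
    intro a b hab hb heq
    rcases Nat.eq_zero_or_pos a with rfl | ha
    · rw [g0, gs b (by omega) hb] at heq
      exact (e _).2.2 heq.symm
    · have := go a b ha hab hb
      rw [heq, orient_self''] at this
      exact lt_irrefl _ this
  refine ⟨g, ginj, ?_, fun a _ => gS a, ?_⟩
  · intro a b c hab hbc hc
    rcases Nat.eq_zero_or_pos a with rfl | ha
    · rw [g0]; exact go b c (by omega) hbc hc
    · by_contra hneg
      have hne := hg (g a) (gS a) (g b) (gS b) (g c) (gS c) (ginj a b hab (by omega))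
        (ginj a c (by omega) hc) (ginj b c hbc hc)
      have hlt0 : orient (g a) (g b) (g c) < 0 := lt_of_le_of_ne (not_lt.1 hneg) hne
      refine hnt o hoS (g a) (gS a) (g c) (gS c) (g b) (gS b) ⟨go a b ha hab (by omega), ?_, ?_⟩
      · rw [orient_swap']; linarith
      · rw [← orient_cyc, orient_cyc, ← orient_cyc, orient_cyc, orient_cyc]
        rw [← orient_cyc, ← orient_cyc]
        have := go b c (by omega) hbc hc
        unfold orient at *; linarith
  · intro x hx
    by_cases hxo : x = o
    · exact ⟨0, hpos, by rw [g0, hxo]⟩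
    · obtain ⟨i, hi⟩ := e.surjective ⟨x, hx, hxo⟩
      refine ⟨i + 1, by omega, ?_⟩
      rw [gs (i + 1) (by omega) (by omega)]
      simp [hi]

lemma exists_cyc {S : Set Pt} (hf : S.Finite) (hn : S.Nonempty) (hg : GenPos S)
    (hnt : ∀ a ∈ S, ∀ b ∈ S, ∀ c ∈ S, ∀ p ∈ S, ¬ InTri a b c p) :
    ∃ q, Cyc S.ncard q S := by
  obtain ⟨g, h1, h2, h3, h4⟩ := exists_enum hf hn hg hnt
  have hpos : 0 < S.ncard := (Set.ncard_pos hf).2 hn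
  set m := S.ncard with hm
  have red : ∀ a b : ℤ, a < b → b < a + m →
      (b % m = b - a + a % m ∨ b % m = b - a + a % m - m) := by
    intro a b _ _
    have e1 := Int.emod_add_mul_ediv a m
    have e2 : b % m = (b - a + a % m) % m := by
      conv_lhs => rw [show b = (b - a + a % m) + m * (a / m) by linarith]
      simp
    have l1 := Int.emod_nonneg a (b := (m : ℤ)) (by omega)
    have l2 := Int.emod_lt_of_pos a (b := (m : ℤ)) (by omega)
    rw [e2]
    by_cases hc : b - a + a % m < m
    · left; exact Int.emod_eq_of_lt (by omega) hc
    · right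
      rw [← Int.sub_emod_right]
      exact Int.emod_eq_of_lt (by omega) (by omega)
  have bd : ∀ a : ℤ, 0 ≤ a % m ∧ a % m < m := fun a =>
    ⟨Int.emod_nonneg a (by omega), Int.emod_lt_of_pos a (by omega)⟩
  refine ⟨fun i => g (i % m).toNat, ?_, ?_, ?_, ?_⟩
  · intro i; simp
  · intro a b hab hb heq
    have := red a b hab hb
    have := bd a
    have := bd b
    have hne : (a % m).toNat ≠ (b % m).toNat := by omega
    rcases lt_or_gt_of_ne hne with h | h
    · exact h1 _ _ h (by omega) heq
    · exact h1 _ _ h (by omega) heq.symm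
  · intro a b c hab hbc hc
    have := red a b hab (by omega)
    have := red a c (by omega) hc
    have := bd a
    have := bd b
    have := bd c
    have hcase : ((a % m).toNat < (b % m).toNat ∧ (b % m).toNat < (c % m).toNat) ∨
      ((b % m).toNat < (c % m).toNat ∧ (c % m).toNat < (a % m).toNat) ∨
      ((c % m).toNat < (a % m).toNat ∧ (a % m).toNat < (b % m).toNat) := by omega
    show 0 < orient (g (a % m).toNat) (g (b % m).toNat) (g (c % m).toNat)
    rcases hcase with h | h | h
    · exact h2 _ _ _ h.1 h.2 (by omega)
    · rw [← orient_cyc]; exact h2 _ _ _ h.1 h.2 (by omega)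
    · rw [← orient_cyc, ← orient_cyc]; exact h2 _ _ _ h.1 h.2 (by omega)
  · ext x; constructor
    · rintro ⟨i, rfl⟩
      exact h3 _ (by have := bd i; omega)
    · intro hx
      obtain ⟨a, ha, rfl⟩ := h4 x hx
      refine ⟨(a : ℤ), ?_⟩
      show g ((a : ℤ) % m).toNat = g a
      rw [Int.emod_eq_of_lt (by omega) (by omega)]; simp

/-! ### One step: from a layer to the next -/

/-- every `y v` is adopted by `q (2v), q (2v+1)` -/
def Adopt (m : ℕ) (y q : ℤ → Pt) : Prop :=
  ∀ v r : ℤ, 2 * v + 1 < r → r < 2 * v + m → InTri (q (2 * v)) (q (2 * v + 1)) (q r) (y v)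

lemma AC.adopt_of_ears {m : ℕ} {q : ℤ → Pt} {P : Set Pt} (h : AC m q P) {p : Pt} (hp : p ∈ P)
    (i r : ℤ) (h1 : orient (q (i - 1)) (q (i + 1)) p < 0)
    (h2 : orient (q i) (q (i + 2)) p < 0) (hr : i + 1 < r) (hr' : r < i + m) :
    InTri (q i) (q (i + 1)) (q r) p := by
  refine ⟨h.left p hp i, ?_, ?_⟩
  · have f := h.flip (i - 1) (i + 1) p
    exact h.shrink hp (r := i + 1) (s := i - 1 + m) (by omega) (by omega) (by omega) (by omega)
      (by linarith)
  · have f := h.flip i (i + 2) p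
    have := h.shrink hp (r := i + 2) (s := i + m) (r' := r) (s' := i + m) (by omega) (by omega)
      (by omega) (by omega) (by linarith)
    rwa [h.per] at this

lemma step_lemma {n : ℕ} (hn : 2 ≤ n) {y q : ℤ → Pt} {P R S : Set Pt} (hR : R = extremePts P)
    (hPf : P.Finite) (hy : Cyc n y R) (hq : Cyc (2 * n) q S) (h : AC (2 * n) q P) :
    ∃ q', Cyc (2 * n) q' S ∧ Adopt (2 * n) y q' := by
  classical
  have c2 : ((2 * n : ℕ) : ℤ) = 2 * n := by push_cast; ring
  have ear : ∀ i : ℤ, ∃ p, p ∈ P ∧ orient (q (i - 1)) (q (i + 1)) p < 0 ∧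
      ∀ p' ∈ P, orient (q (i - 1)) (q (i + 1)) p' < 0 → p' = p := by
    intro i
    obtain ⟨p, hp, ht, hu⟩ := h.uniq (i - 1) i (i + 1) (by omega) (by omega) (by omega)
    refine ⟨p, hp, ?_, ?_⟩
    · have := ht.2.2; rw [orient_swap] at this; linarith
    · intro p' hp' hneg
      refine hu p' hp' ⟨?_, h.left p' hp' i, ?_⟩
      · have := h.left p' hp' (i - 1); rwa [sub_add_cancel] at this
      · rw [orient_swap]; linarith
  choose E hEP hEneg hEu using ear
  have e1 : ∀ i : ℤ, E (i + (2 * n : ℕ)) = E i := by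
    intro i
    apply hEu i _ (hEP _)
    have := hEneg (i + (2 * n : ℕ))
    rw [show i + ((2 * n : ℕ) : ℤ) - 1 = i - 1 + (2 * n : ℕ) by ring,
      show i + ((2 * n : ℕ) : ℤ) + 1 = i + 1 + (2 * n : ℕ) by ring, h.per, h.per] at this
    exact this
  have e2 : ∀ i i' : ℤ, i + 2 ≤ i' → i' ≤ i + 2 * n - 2 → E i ≠ E i' := by
    intro i i' h1 h2 heq
    have a1 := hEneg i
    have a2 := hEneg i'
    rw [← heq] at a2
    exact h.disjoint (hEP i) (r := i - 1) (s := i + 1) (r' := i' - 1) (s' := i' + 1)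
      (by omega) (by omega) (by omega) (by omega) a1 a2
  have e3 : ∀ i, E i ∈ R := by
    intro i
    rw [hR]
    refine mem_extremePts_of_sep hPf (hEP i) (hEneg i) (fun x hx hne => ?_)
    by_contra hlt
    exact hne (hEu i x hx (not_le.1 hlt))
  have hRf : R.Finite := by rw [hR]; exact hPf.subset (extremePts_subset P)
  have hRc : R.ncard = n := by rw [← hy.rng]; exact ncard_range (by omega) hy.per hy.inj
  have partner : ∀ i, E (i + 1) = E i ∨ E (i - 1) = E i := by
    intro i
    by_contra hcon
    push Not at hcon
    obtain ⟨hc1, hc2⟩ := hcon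
    have hmaps : ∀ a ∈ Finset.Ico (i + 1) (i + 2 * n), E a ∈ hRf.toFinset.erase (E i) := by
      intro a ha
      rw [Finset.mem_Ico] at ha
      rw [Finset.mem_erase]
      refine ⟨?_, by simpa using e3 a⟩
      intro heq
      by_cases h1 : a = i + 1
      · rw [h1] at heq; exact hc1 heq
      by_cases h2 : a = i + 2 * n - 1
      · apply hc2
        rw [← heq, h2, ← e1 (i - 1)]; congr 1; push_cast; ring
      · exact e2 i a (by omega) (by omega) heq.symm
    have hcd : (hRf.toFinset.erase (E i)).card = n - 1 := by
      rw [Finset.card_erase_of_mem (by simpa using e3 i), ← Set.ncard_eq_toFinset_card _ hRf, hRc]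
    obtain ⟨z, -, hz⟩ := Finset.exists_lt_card_fiber_of_mul_lt_card_of_maps_to (n := 2) hmaps (by
      rw [hcd]; simp; omega)
    obtain ⟨a, b, c, ha, hb, hc, hab, hac, hbc⟩ := Finset.two_lt_card_iff.1 hz
    simp only [Finset.mem_filter, Finset.mem_Ico] at ha hb hc
    have far : ∀ s t : ℤ, (i + 1 ≤ s ∧ s < i + 2 * n) → (i + 1 ≤ t ∧ t < i + 2 * n) →
        E s = z → E t = z → ¬ (s + 2 ≤ t) := by
      intro s t hs ht h1 h2 hst
      exact e2 s t hst (by omega) (h1.trans h2.symm)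
    have f1 := far a b ha.1 hb.1 ha.2 hb.2
    have f2 := far b a hb.1 ha.1 hb.2 ha.2
    have f3 := far a c ha.1 hc.1 ha.2 hc.2
    have f4 := far c a hc.1 ha.1 hc.2 ha.2
    have f5 := far b c hb.1 hc.1 hb.2 hc.2
    have f6 := far c b hc.1 hb.1 hc.2 hb.2
    omega
  obtain ⟨t, ht⟩ : ∃ t : ℤ, E t = E (t + 1) := by
    rcases partner 0 with hh | hh
    · exact ⟨0, hh.symm⟩
    · exact ⟨-1, by simpa using hh⟩
  have pair : ∀ v : ℤ, E (2 * v + t) = E (2 * v + t + 1) := by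
    intro v
    induction v using Int.induction_on with
    | zero => simpa using ht
    | succ v ih =>
      rcases partner (2 * (v + 1) + t) with hh | hh
      · exact hh.symm
      · exfalso
        rw [show (2 * ((v : ℤ) + 1) + t - 1) = 2 * v + t + 1 by ring, ← ih] at hh
        exact e2 _ _ (by omega) (by omega) hh
    | pred v ih =>
      rcases partner (2 * (-(v : ℤ) - 1) + t + 1) with hh | hh
      · exfalso
        rw [show (2 * (-(v : ℤ) - 1) + t + 1 + 1) = 2 * (-v) + t by ring, ih] at hh
        exact e2 _ _ (by omega) (by omega) hh.symm
      · rwa [show (2 * (-(v : ℤ) - 1) + t + 1 - 1) = 2 * (-(v : ℤ) - 1) + t by ring] at hh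
  have had : ∀ v r : ℤ, 2 * v + t + 1 < r → r < 2 * v + t + (2 * n : ℕ) →
      InTri (q (2 * v + t)) (q (2 * v + t + 1)) (q r) (E (2 * v + t)) := by
    intro v r h1 h2
    refine h.adopt_of_ears (hEP _) _ _ (hEneg _) ?_ h1 h2
    have := hEneg (2 * v + t + 1)
    rw [← pair, add_sub_cancel_right] at this
    rwa [show 2 * v + t + 1 + 1 = 2 * v + t + 2 by ring] at this
  have hper : ∀ v : ℤ, E (2 * (v + n) + t) = E (2 * v + t) := by
    intro v
    rw [← e1 (2 * v + t)]; congr 1; push_cast; ring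
  have hinj : ∀ a b : ℤ, a < b → b < a + n → E (2 * a + t) ≠ E (2 * b + t) := by
    intro a b h1 h2; exact e2 _ _ (by omega) (by omega)
  have hE : Cyc n (fun v => E (2 * v + t)) R := by
    refine ⟨hper, hinj, ?_, ?_⟩
    · intro a b c hab hbc hc
      show 0 < orient (E (2 * a + t)) (E (2 * b + t)) (E (2 * c + t))
      have q1 := fun r h1 h2 => had a r h1 h2
      have pr := h.per
      have A1 := had a (2 * b + t) (by omega) (by omega)
      have A2 := had a (2 * b + t + 1) (by omega) (by omega)
      have B1 := had b (2 * a + t + (2 * n : ℕ)) (by omega) (by omega)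
      have B2 := had b (2 * a + t + 1 + (2 * n : ℕ)) (by omega) (by omega)
      rw [h.per] at B1 B2
      have A3 := had a (2 * c + t) (by omega) (by omega)
      have A4 := had a (2 * c + t + 1) (by omega) (by omega)
      have C1 := had c (2 * a + t + (2 * n : ℕ)) (by omega) (by omega)
      have C2 := had c (2 * a + t + 1 + (2 * n : ℕ)) (by omega) (by omega)
      rw [h.per] at C1 C2
      have D1 : 0 < orient (E (2 * a + t)) (E (2 * b + t)) (q (2 * c + t)) :=
        transfer_pos A1 A2 B1 B2
          (h.pos _ _ _ (by omega) (by omega) (by omega)) (h.pos _ _ _ (by omega) (by omega) (by omega))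
          (h.pos _ _ _ (by omega) (by omega) (by omega)) (h.pos _ _ _ (by omega) (by omega) (by omega))
      have D2 : 0 < orient (E (2 * a + t)) (E (2 * b + t)) (q (2 * c + t + 1)) :=
        transfer_pos A1 A2 B1 B2
          (h.pos _ _ _ (by omega) (by omega) (by omega)) (h.pos _ _ _ (by omega) (by omega) (by omega))
          (h.pos _ _ _ (by omega) (by omega) (by omega)) (h.pos _ _ _ (by omega) (by omega) (by omega))
      have Q := quad A3 A4 C1 C2
      rw [← orient_cyc, ← orient_cyc]
      refine orient_pos_of_inTri Q ?_ ?_ ?_ (Or.inl ?_)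
      · rw [orient_cyc, orient_cyc]; exact D1.le
      · rw [orient_cyc, orient_cyc]; exact D2.le
      · rw [orient_self]
      · rw [orient_cyc, orient_cyc]; exact D1
    · refine Set.eq_of_subset_of_ncard_le ?_ ?_ hRf
      · rintro _ ⟨v, rfl⟩; exact e3 _
      · rw [hRc, ncard_range (q := fun v => E (2 * v + t)) (by omega) hper hinj]
  obtain ⟨s, hs⟩ := hy.unique hE hn
  refine ⟨_, hq.shift (2 * s + t), ?_⟩
  intro v r h1 h2
  have := had (v + s) (r + (2 * s + t)) (by omega) (by omega)
  rw [hs v]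
  show InTri (q (2*v + (2*s+t))) (q (2*v+1+(2*s+t))) (q (r+(2*s+t))) (E (2*(v+s)+t))
  rw [show 2 * (v + s) + t = 2 * v + (2 * s + t) by ring] at this
  rw [show 2 * v + 1 + (2 * s + t) = 2 * v + (2 * s + t) + 1 by ring,
    show 2 * (v + s) + t = 2 * v + (2 * s + t) by ring]
  exact this

/-- inner points see the children of `y v` in the same way as `y v` itself -/
lemma onestep {n : ℕ} {y q : ℤ → Pt} {P : Set Pt} (h : AC (2 * n) q P) (hA : Adopt (2 * n) y q)
    (hyP : ∀ v, y v ∈ P) {p : Pt} (hp : p ∈ P) (hpy : ∀ v, p ≠ y v) {v v' : ℤ} (h1 : v < v')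
    (h2 : v' < v + n) {e e' : ℤ} (he : e = 0 ∨ e = 1) (he' : e' = 0 ∨ e' = 1) :
    0 < orient (y v) (y v') p ↔ 0 < orient (q (2 * v + e)) (q (2 * v' + e')) p := by
  have c2 : ((2 * n : ℕ) : ℤ) = 2 * n := by push_cast; ring
  have eqv : ∀ v r : ℤ, 2 * v + 1 < r → r < 2 * v + (2 * n : ℕ) →
      (0 < orient (q (2 * v)) (q r) p ↔ 0 < orient (q (2 * v + 1)) (q r) p) := by
    intro v r h1 h2
    constructor
    · intro hh; exact h.mono2 hp (by omega) h1 h2 hh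
    · intro hh
      by_contra hneg
      have hne := h.gp p hp (2 * v) r (by omega) h2
      have hlt : orient (q (2 * v)) (q r) p < 0 := lt_of_le_of_ne (not_lt.1 hneg) hne
      obtain ⟨p0, hp0, -, hu⟩ := h.uniq (2 * v) (2 * v + 1) r (by omega) h1 h2
      have a1 := hu p hp ⟨h.left p hp _, hh, by rw [orient_swap]; linarith⟩
      have a2 := hu (y v) (hyP v) (hA v r h1 h2)
      exact hpy v (a1.trans a2.symm)
  have g1 := eqv v (2 * v') (by omega) (by omega)
  have g2 := eqv v (2 * v' + 1) (by omega) (by omega)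
  have g3 := eqv v' (2 * v + (2 * n : ℕ)) (by omega) (by omega)
  have n1 := h.gp p hp (2 * v) (2 * v') (by omega) (by omega)
  have n2 := h.gp p hp (2 * v) (2 * v' + 1) (by omega) (by omega)
  have n3 := h.gp p hp (2 * v + 1) (2 * v') (by omega) (by omega)
  have n4 := h.gp p hp (2 * v + 1) (2 * v' + 1) (by omega) (by omega)
  rw [h.flip, h.flip] at g3
  have A1 := hA v (2 * v') (by omega) (by omega)
  have A2 := hA v (2 * v' + 1) (by omega) (by omega)
  have B1 := hA v' (2 * v + (2 * n : ℕ)) (by omega) (by omega)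
  have B2 := hA v' (2 * v + 1 + (2 * n : ℕ)) (by omega) (by omega)
  rw [h.per] at B1 B2
  have ng : ∀ x : ℝ, x ≠ 0 → ¬ 0 < x → x < 0 := fun x hx h => lt_of_le_of_ne (not_lt.1 h) hx
  by_cases hh : 0 < orient (q (2 * v)) (q (2 * v')) p
  · have k1 := g1.1 hh
    have k2 : 0 < orient (q (2 * v)) (q (2 * v' + 1)) p := by
      by_contra hc
      have := ng _ n2 hc
      have := g3.2 (by linarith)
      linarith
    have k3 := g2.1 k2
    have k := transfer_pos A1 A2 B1 B2 hh k2 k1 k3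
    refine iff_of_true k ?_
    rcases he with rfl | rfl <;> rcases he' with rfl | rfl <;> simpa using by assumption
  · have k0 := ng _ n1 hh
    have k1 := ng _ n3 (fun h => hh (g1.2 h))
    have k2 : orient (q (2 * v)) (q (2 * v' + 1)) p < 0 := by
      have := g3.1 (by linarith)
      linarith
    have k3 := ng _ n4 (fun h => absurd (g2.2 h) (by linarith))
    have k := transfer_neg A1 A2 B1 B2 k0 k2 k1 k3
    refine iff_of_false (by linarith) ?_
    rcases he with rfl | rfl <;> rcases he' with rfl | rfl <;>
      (try simp only [add_zero]) <;> linarith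

/-! ### Layers -/

/-- The facts about convex layers that are used. -/
structure Tw (k : ℕ) (Y R : ℕ → Set Pt) : Prop where
  fin : ∀ j, (Y j).Finite
  gp : ∀ j, GenPos (Y j)
  req : ∀ j, R j = extremePts (Y j)
  ypred : ∀ j, j < k → Y j = Y (j + 1) \ R (j + 1)
  y0 : Y 0 = ∅
  ne : ∀ j, 1 ≤ j → j ≤ k → (Y j).Nonempty
  uni : ∀ j, j < k → ∀ a ∈ R (j + 1), ∀ b ∈ R (j + 1), ∀ c ∈ R (j + 1), a ≠ b → a ≠ c → b ≠ c →
    ∃! p : Pt, p ∈ Y j ∩ interior (convexHull ℝ ({a, b, c} : Set Pt))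

lemma peel_subset (S : Set Pt) : peel S ⊆ S := Set.sdiff_subset

lemma peel_iter_subset (S : Set Pt) (j : ℕ) : peel^[j] S ⊆ S := by
  induction j with
  | zero => exact subset_rfl
  | succ j ih =>
    rw [Function.iterate_succ_apply']
    exact (peel_subset _).trans ih

lemma peel_card {S : Set Pt} (hf : S.Finite) (hn : S.Nonempty) : (peel S).ncard < S.ncard := by
  apply Set.ncard_lt_ncard _ hf
  refine ⟨peel_subset S, fun h => ?_⟩
  obtain ⟨x, hx⟩ := extremePts_nonempty hf hn
  exact (h (extremePts_subset S hx)).2 hx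

lemma exists_hasLayers {X : Set Pt} (hf : X.Finite) (hn : X.Nonempty) :
    ∃ k, 1 ≤ k ∧ HasLayers X k := by
  classical
  have hex : ∃ k, peel^[k] X = ∅ := by
    by_contra hcon
    push Not at hcon
    have : ∀ j, (peel^[j] X).ncard + j ≤ X.ncard := by
      intro j
      induction j with
      | zero => simp
      | succ j ih =>
        rw [Function.iterate_succ_apply']
        have := peel_card (hf.subset (peel_iter_subset X j)) (hcon j)
        omega
    have := this (X.ncard + 1)
    omega
  refine ⟨Nat.find hex, ?_, Nat.find_spec hex, fun j hj => Nat.find_min hex hj⟩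
  by_contra h
  have h0 : Nat.find hex = 0 := by omega
  have := Nat.find_spec hex
  rw [h0] at this
  exact hn.ne_empty this

lemma tw_of_nacs {X : Set Pt} (hX : IsNACS X) {k : ℕ} (hk : HasLayers X k) :
    Tw k (layerSub X k) (layer X k) := by
  obtain ⟨hf, hn, hg, hu⟩ := hX
  refine ⟨fun j => hf.subset (peel_iter_subset _ _), ?_, fun j => rfl, ?_, ?_, ?_, ?_⟩
  · intro j a ha b hb c hc
    exact hg a (peel_iter_subset _ _ ha) b (peel_iter_subset _ _ hb) c (peel_iter_subset _ _ hc)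
  · intro j hj
    show peel^[k - j] X = peel (peel^[k - (j + 1)] X)
    rw [← Function.iterate_succ_apply' peel]
    congr 1; omega
  · exact hk.1
  · intro j h1 h2
    exact Set.nonempty_iff_ne_empty.2 (hk.2 (k - j) (by omega))
  · intro j hj a ha b hb c hc hab hac hbc
    have := hu k hk (j + 1) (by omega) (by omega) a ha b hb c hc hab hac hbc
    simpa using this

namespace Tw

variable {k : ℕ} {Y R : ℕ → Set Pt}

lemma rsub (h : Tw k Y R) (j : ℕ) : R j ⊆ Y j := by
  rw [h.req]; exact extremePts_subset _

lemma mono (h : Tw k Y R) {j : ℕ} (d : ℕ) (hd : j + d ≤ k) : Y j ⊆ Y (j + d) := by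
  induction d with
  | zero => exact subset_rfl
  | succ d ih =>
    refine (ih (by omega)).trans ?_
    rw [h.ypred (j + d) (by omega)]
    exact Set.sdiff_subset

lemma not_mem (h : Tw k Y R) {j : ℕ} (hj : j < k) {p : Pt} (hp : p ∈ Y j) : p ∉ R (j + 1) := by
  rw [h.ypred j hj] at hp; exact hp.2

lemma mem_hull (h : Tw k Y R) {j : ℕ} (hj : j < k) {p : Pt} (hp : p ∈ Y j) :
    p ∈ convexHull ℝ (R (j + 1)) := by
  rw [h.req, hull_extremePts_s7 (h.fin _)]
  exact subset_convexHull _ _ (h.mono 1 (by omega) hp)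

lemma rfin (h : Tw k Y R) (j : ℕ) : (R j).Finite := (h.fin j).subset (h.rsub j)

lemma rne (h : Tw k Y R) {j : ℕ} (h1 : 1 ≤ j) (h2 : j ≤ k) : (R j).Nonempty := by
  rw [h.req]; exact extremePts_nonempty (h.fin j) (h.ne j h1 h2)

lemma card_ge (h : Tw k Y R) {j : ℕ} (hj : j < k) {p : Pt} (hp : p ∈ Y j) :
    3 ≤ (R (j + 1)).ncard := by
  by_contra hlt
  have hpos : 0 < (R (j + 1)).ncard := (Set.ncard_pos (h.rfin _)).2 (h.rne (by omega) (by omega))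
  have hh := h.mem_hull hj hp
  have hnm := h.not_mem hj hp
  have hcase : (R (j + 1)).ncard = 1 ∨ (R (j + 1)).ncard = 2 := by omega
  rcases hcase with hc | hc
  · obtain ⟨a, ha⟩ := Set.ncard_eq_one.1 hc
    rw [ha] at hh hnm
    rw [convexHull_singleton] at hh
    exact hnm hh
  · obtain ⟨a, b, hab, he⟩ := Set.ncard_eq_two.1 hc
    have haR : a ∈ R (j + 1) := by rw [he]; simp
    have hbR : b ∈ R (j + 1) := by rw [he]; simp
    have g := h.gp (j + 1) a (h.rsub _ haR) b (h.rsub _ hbR) p (h.mono 1 (by omega) hp) hab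
      (by rintro rfl; exact hnm haR) (by rintro rfl; exact hnm hbR)
    have s1 : 0 ≤ orient a b p := by
      refine orient_nonneg_of_hull hh ?_
      rw [he]; rintro s (rfl | rfl)
      · rw [orient_self']
      · rw [orient_self'']
    have s2 : 0 ≤ orient b a p := by
      refine orient_nonneg_of_hull hh ?_
      rw [he]; rintro s (rfl | rfl)
      · rw [orient_self'']
      · rw [orient_self']
    rw [orient_swap] at s2
    exact g (by linarith)

lemma ex_cyc (h : Tw k Y R) {j : ℕ} (h1 : 1 ≤ j) (h2 : j ≤ k) :
    ∃ q, Cyc (R j).ncard q (R j) := by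
  refine exists_cyc (h.rfin j) (h.rne h1 h2) ?_ ?_
  · intro a ha b hb c hc
    exact h.gp j a (h.rsub j ha) b (h.rsub j hb) c (h.rsub j hc)
  · intro a ha b hb c hc p hp
    exact not_inTri_extremePts (h.rsub j ha) (h.rsub j hb) (h.rsub j hc) (h.req j ▸ hp)

lemma ac (h : Tw k Y R) {j : ℕ} (hj : j < k) {m : ℕ} (hm : 2 ≤ m) {q : ℤ → Pt}
    (hq : Cyc m q (R (j + 1))) : AC m q (Y j) := by
  have hgp : ∀ p ∈ Y j, ∀ i j : ℤ, i < j → j < i + m → orient (q i) (q j) p ≠ 0 := by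
    intro p hp i j' h1 h2
    have hnm := h.not_mem hj hp
    exact h.gp (j + 1) _ (h.rsub _ (hq.mem i)) _ (h.rsub _ (hq.mem j')) p (h.mono 1 (by omega) hp)
      (hq.inj _ _ h1 h2) (fun e => hnm (e ▸ hq.mem i)) (fun e => hnm (e ▸ hq.mem j'))
  refine ⟨hq.per, hq.pos, ?_, hgp, ?_⟩
  · intro p hp i
    refine lt_of_le_of_ne ?_ (hgp p hp i (i + 1) (by omega) (by omega)).symm
    refine orient_nonneg_of_hull (h.mem_hull hj hp) ?_
    intro s hs
    by_cases e1 : s = q i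
    · rw [e1, orient_self']
    by_cases e2 : s = q (i + 1)
    · rw [e2, orient_self'']
    exact (hq.succ_pos (by omega) hs i e1 e2).le
  · intro a b c hab hbc hc
    have hpos := hq.pos a b c hab hbc hc
    obtain ⟨p, ⟨hp, hpi⟩, hu⟩ := h.uni j hj _ (hq.mem a) _ (hq.mem b) _ (hq.mem c)
      (hq.inj _ _ hab (by omega)) (hq.inj _ _ (by omega) hc) (hq.inj _ _ hbc (by omega))
    refine ⟨p, hp, ⟨?_, ?_, ?_⟩, fun p' hp' ht => hu p' ⟨hp', mem_interior_of_inTri ht⟩⟩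
    · refine lt_of_le_of_ne ?_ (hgp p hp a b (by omega) (by omega)).symm
      refine orient_nonneg_of_hull (interior_subset hpi) ?_
      rintro s (rfl | rfl | rfl)
      · rw [orient_self']
      · rw [orient_self'']
      · exact hpos.le
    · refine lt_of_le_of_ne ?_ (hgp p hp b c (by omega) (by omega)).symm
      refine orient_nonneg_of_hull (interior_subset hpi) ?_
      rintro s (rfl | rfl | rfl)
      · rw [orient_cyc]; exact hpos.le
      · rw [orient_self']
      · rw [orient_self'']
    · have := hgp p hp c (a + m) (by omega) (by omega)
      rw [hq.per] at this
      refine lt_of_le_of_ne ?_ this.symm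
      refine orient_nonneg_of_hull (interior_subset hpi) ?_
      rintro s (rfl | rfl | rfl)
      · rw [orient_self'']
      · rw [orient_cyc, orient_cyc]; exact hpos.le
      · rw [orient_self']

lemma card_one (h : Tw k Y R) (hk : 1 ≤ k) : (R 1).ncard = 1 ∨ (R 1).ncard = 2 := by
  have hpos : 0 < (R 1).ncard := (Set.ncard_pos (h.rfin _)).2 (h.rne le_rfl hk)
  by_contra hcon
  have h2 : 2 < (R 1).ncard := by omega
  obtain ⟨a, b, c, ha, hb, hc, hab, hac, hbc⟩ := (Set.two_lt_ncard_iff (h.rfin 1)).1 h2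
  obtain ⟨p, ⟨hp, -⟩, -⟩ := h.uni 0 hk a ha b hb c hc hab hac hbc
  rw [h.y0] at hp
  exact hp

lemma y_one (h : Tw k Y R) (hk : 1 ≤ k) : Y 1 = R 1 := by
  have := h.ypred 0 hk
  rw [h.y0] at this
  exact subset_antisymm (Set.sdiff_eq_empty.1 this.symm) (h.rsub 1)

lemma card_next (h : Tw k Y R) {j : ℕ} (h1 : 1 ≤ j) (hj : j < k) :
    (R (j + 1)).ncard = (Y j).ncard + 2 := by
  obtain ⟨p, hp⟩ := h.ne j h1 hj.le
  have h3 := h.card_ge hj hp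
  obtain ⟨q, hq⟩ := h.ex_cyc (j := j + 1) (by omega) (by omega)
  have := (h.ac hj (by omega) hq).ncard h3
  omega

lemma card_y (h : Tw k Y R) {j : ℕ} (hj : j < k) :
    (Y (j + 1)).ncard = (Y j).ncard + (R (j + 1)).ncard := by
  have := Set.ncard_sdiff_add_ncard_of_subset (h.rsub (j + 1)) (h.fin _)
  rw [← h.ypred j hj] at this
  exact this.symm

lemma card_two (h : Tw k Y R) (hk : 2 ≤ k) : (R 2).ncard = (R 1).ncard + 2 := by
  rw [h.card_next le_rfl hk, h.y_one (by omega)]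

lemma card_double (h : Tw k Y R) {j : ℕ} (h1 : 2 ≤ j) (hj : j < k) :
    (R (j + 1)).ncard = 2 * (R j).ncard := by
  obtain ⟨i, rfl⟩ : ∃ i, j = i + 1 := ⟨j - 1, by omega⟩
  have a1 := h.card_next (j := i + 1) (by omega) hj
  have a2 := h.card_next (j := i) (by omega) (by omega)
  have a3 := h.card_y (j := i) (by omega)
  omega

end Tw

/-- A compatible system of enumerations of the layers `R (j₁+1), R (j₁+2), …`. -/
structure Tower (k n j₁ : ℕ) (R : ℕ → Set Pt) (Q : ℕ → ℤ → Pt) : Prop where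
  cyc : ∀ i, j₁ + i + 1 ≤ k → Cyc (n * 2 ^ i) (Q i) (R (j₁ + i + 1))
  ad : ∀ i, j₁ + i + 2 ≤ k → Adopt (n * 2 ^ (i + 1)) (Q i) (Q (i + 1))

lemma exists_tower {k n j₁ : ℕ} {Y R : ℕ → Set Pt} (h : Tw k Y R) (hn : 2 ≤ n)
    (hk : j₁ + 1 ≤ k) (h0 : (R (j₁ + 1)).ncard = n)
    (hd : ∀ i, j₁ + i + 2 ≤ k → (R (j₁ + i + 2)).ncard = 2 * (R (j₁ + i + 1)).ncard) :
    ∃ Q, Tower k n j₁ R Q := by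
  have hc : ∀ i, j₁ + i + 1 ≤ k → (R (j₁ + i + 1)).ncard = n * 2 ^ i := by
    intro i
    induction i with
    | zero => intro _; simpa using h0
    | succ i ih =>
      intro hi
      have := hd i (by omega)
      rw [show j₁ + (i + 1) + 1 = j₁ + i + 2 by ring, this, ih (by omega)]
      ring
  have step : ∀ (i : ℕ) (y : ℤ → Pt), ∃ q, j₁ + i + 2 ≤ k → Cyc (n * 2 ^ i) y (R (j₁ + i + 1)) →
      Cyc (n * 2 ^ (i + 1)) q (R (j₁ + i + 2)) ∧ Adopt (n * 2 ^ (i + 1)) y q := by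
    intro i y
    by_cases hi : j₁ + i + 2 ≤ k
    · by_cases hy : Cyc (n * 2 ^ i) y (R (j₁ + i + 1))
      · obtain ⟨q, hq⟩ := h.ex_cyc (j := j₁ + i + 2) (by omega) hi
        have e : n * 2 ^ (i + 1) = 2 * (n * 2 ^ i) := by ring
        rw [hd i hi, hc i (by omega)] at hq
        have hN : 2 ≤ n * 2 ^ i := le_trans hn (Nat.le_mul_of_pos_right _ (by positivity))
        have hac := h.ac (j := j₁ + i + 1) (by omega) (by omega) hq
        obtain ⟨q', h1, h2⟩ := step_lemma hN (h.req _) (h.fin _) hy hq hac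
        exact ⟨q', fun _ _ => by rw [e]; exact ⟨h1, h2⟩⟩
      · exact ⟨y, fun _ h => absurd h hy⟩
    · exact ⟨y, fun h => absurd h hi⟩
  choose f hf using step
  obtain ⟨q0, hq0⟩ := h.ex_cyc (j := j₁ + 1) (by omega) hk
  rw [h0] at hq0
  let Q : ℕ → ℤ → Pt := fun i => Nat.rec q0 (fun i y => f i y) i
  have hQ : ∀ i, j₁ + i + 1 ≤ k → Cyc (n * 2 ^ i) (Q i) (R (j₁ + i + 1)) := by
    intro i
    induction i with
    | zero => intro _; rw [pow_zero, mul_one]; exact hq0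
    | succ i ih => intro hi; exact (hf i (Q i) (by omega) (ih (by omega))).1
  exact ⟨Q, hQ, fun i hi => (hf i (Q i) hi (hQ i (by omega))).2⟩

namespace Tower

variable {k n j₁ : ℕ} {Y R : ℕ → Set Pt} {Q : ℕ → ℤ → Pt}

lemma transfer (hT : Tower k n j₁ R Q) (h : Tw k Y R) (hn : 2 ≤ n) {i : ℕ} {p : Pt}
    (hp : p ∈ Y (j₁ + i)) (d : ℕ) (hd : j₁ + i + d + 1 ≤ k) :
    ∀ v v' e e' : ℤ, v < v' → v' < v + (n * 2 ^ i : ℕ) → 0 ≤ e → e < 2 ^ d → 0 ≤ e' → e' < 2 ^ d →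
      (0 < orient (Q i v) (Q i v') p ↔
        0 < orient (Q (i + d) (v * 2 ^ d + e)) (Q (i + d) (v' * 2 ^ d + e')) p) := by
  induction d with
  | zero =>
    intro v v' e e' _ _ h1 h2 h3 h4
    have : e = 0 := by simp at h2; omega
    have : e' = 0 := by simp at h4; omega
    subst e e'
    simp
  | succ d ih =>
    intro v v' e e' hv hv' h1 h2 h3 h4
    rw [pow_succ] at h2 h4
    rw [ih (by omega) v v' (e / 2) (e' / 2) hv hv' (by omega) (by omega) (by omega) (by omega)]
    have E : n * 2 ^ (i + d + 1) = 2 * (n * 2 ^ (i + d)) := by ring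
    have hcyc := hT.cyc (i + d + 1) (by omega)
    have had := hT.ad (i + d) (by omega)
    rw [E] at hcyc had
    rw [show j₁ + (i + d + 1) + 1 = j₁ + i + d + 1 + 1 by ring] at hcyc
    have hN : 2 ≤ n * 2 ^ (i + d) := le_trans hn (Nat.le_mul_of_pos_right _ (by positivity))
    have hac := h.ac (j := j₁ + i + d + 1) (m := 2 * (n * 2 ^ (i + d))) (by omega) (by omega) hcyc
    have hp1 : p ∈ Y (j₁ + i + d) := h.mono d (by omega) hp
    have hp2 : p ∈ Y (j₁ + i + d + 1) := h.mono 1 (by omega) hp1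
    have hy := hT.cyc (i + d) (by omega)
    rw [← add_assoc] at hy
    have hD : (0 : ℤ) < 2 ^ d := by positivity
    have m1 : (v + 1) * 2 ^ d ≤ v' * 2 ^ d := mul_le_mul_of_nonneg_right (by omega) hD.le
    have m2 : (v' + 1) * 2 ^ d ≤ (v + (n * 2 ^ i : ℕ)) * 2 ^ d :=
      mul_le_mul_of_nonneg_right (by omega) hD.le
    have c1 : ((n * 2 ^ i : ℕ) : ℤ) * 2 ^ d = ((n * 2 ^ (i + d) : ℕ) : ℤ) := by push_cast; ring
    rw [add_mul v, c1] at m2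
    rw [add_mul] at m1 m2
    have := onestep hac had (fun v => h.rsub _ (hy.mem v)) hp2
      (fun v e => h.not_mem (j := j₁ + i + d) (by omega) hp1 (e ▸ hy.mem v))
      (v := v * 2 ^ d + e / 2) (v' := v' * 2 ^ d + e' / 2) (by omega) (by omega)
      (e := e % 2) (e' := e' % 2) (by omega) (by omega)
    rw [this]
    have z1 : 2 * (v * 2 ^ d + e / 2) + e % 2 = v * 2 ^ (d + 1) + e := by
      rw [pow_succ, ← mul_assoc]; omega
    have z2 : 2 * (v' * 2 ^ d + e' / 2) + e' % 2 = v' * 2 ^ (d + 1) + e' := by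
      rw [pow_succ, ← mul_assoc]; omega
    rw [z1, z2]
    rfl

lemma wellLaid (hT : Tower k n j₁ R Q) (h : Tw k Y R) (hn : 2 ≤ n) {i : ℕ} (d : ℕ)
    (hd : j₁ + i + d + 1 ≤ k) (v : ℤ) :
    Q i v ∈ convexHull ℝ ({Q (i + d) (v * 2 ^ d - 1), Q (i + d) (v * 2 ^ d),
      Q (i + d) ((v + 1) * 2 ^ d - 1)} : Set Pt) ∧
    Q i v ∈ convexHull ℝ ({Q (i + d) (v * 2 ^ d),
      Q (i + d) ((v + 1) * 2 ^ d - 1), Q (i + d) ((v + 1) * 2 ^ d)} : Set Pt) := by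
  rcases d with _ | D
  · constructor <;> apply subset_convexHull <;> simp
  · have had := hT.ad i (by omega)
    have hp : Q i v ∈ Y (j₁ + (i + 1)) := h.rsub _ ((hT.cyc i (by omega)).mem v)
    have tr := hT.transfer h hn hp D (by omega)
    have hK := (hT.cyc (i + 1 + D) (by omega)).per
    have hM := (hT.cyc (i + 1) (by omega)).per
    have hN : 2 ≤ n * 2 ^ i := le_trans hn (Nat.le_mul_of_pos_right _ (by positivity))
    have E : n * 2 ^ (i + 1) = 2 * (n * 2 ^ i) := by ring
    have c1 : ((n * 2 ^ (i + 1) : ℕ) : ℤ) * 2 ^ D = ((n * 2 ^ (i + 1 + D) : ℕ) : ℤ) := by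
      push_cast; ring
    have eK : i + (D + 1) = i + 1 + D := by ring
    rw [eK]
    generalize n * 2 ^ (i + 1) = M at *
    have hD : (0 : ℤ) < 2 ^ D := by positivity
    have A := had v (2 * v + 2) (by omega) (by omega)
    have B := had v (2 * v - 1 + M) (by omega) (by omega)
    have a1 := (tr (2 * v) (2 * v + 1) 0 (2 ^ D - 1) (by omega) (by omega) le_rfl hD (by omega)
      (by omega)).1 A.1
    have a2 := (tr (2 * v + 1) (2 * v + 2) (2 ^ D - 1) 0 (by omega) (by omega) (by omega) (by omega)
      le_rfl hD).1 A.2.1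
    have a3 := (tr (2 * v + 2) (2 * v + M) 0 0 (by omega) (by omega) le_rfl hD le_rfl hD).1
      (by rw [hM]; exact A.2.2)
    have b2 := (tr (2 * v + 1) (2 * v - 1 + M) (2 ^ D - 1) (2 ^ D - 1) (by omega) (by omega)
      (by omega) (by omega) (by omega) (by omega)).1 B.2.1
    have b3 := (tr (2 * v - 1 + M) (2 * v + M) (2 ^ D - 1) 0 (by omega) (by omega) (by omega)
      (by omega) le_rfl hD).1 (by rw [hM (2 * v)]; exact B.2.2)
    have w1 : 2 * v * 2 ^ D + 0 = v * 2 ^ (D + 1) := by ring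
    have w2 : (2 * v + 1) * 2 ^ D + (2 ^ D - 1) = (v + 1) * 2 ^ (D + 1) - 1 := by ring
    have w3 : (2 * v + 2) * 2 ^ D + 0 = (v + 1) * 2 ^ (D + 1) := by ring
    have w4 : (2 * v + M) * 2 ^ D + 0 = v * 2 ^ (D + 1) + (n * 2 ^ (i + 1 + D) : ℕ) := by
      rw [← c1]; ring
    have w5 : (2 * v - 1 + M) * 2 ^ D + (2 ^ D - 1) =
        v * 2 ^ (D + 1) - 1 + (n * 2 ^ (i + 1 + D) : ℕ) := by
      rw [← c1]; ring
    rw [w1, w2] at a1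
    rw [w2, w3] at a2
    rw [w3, w4, hK] at a3
    rw [w2, w5, hK] at b2
    rw [w4, w5, hK, hK] at b3
    exact ⟨mem_hull_of_inTri ⟨b3, a1, b2⟩, mem_hull_of_inTri ⟨a1, a2, a3⟩⟩

lemma adoptable (hT : Tower k n j₁ R Q) (hn : 2 ≤ n) {i : ℕ} (hd : j₁ + i + 2 ≤ k) (v : ℤ) :
    AdoptablePair (R (j₁ + i + 2)) (Q i v) (Q (i + 1) (2 * v)) (Q (i + 1) (2 * v + 1)) := by
  rintro q3 ⟨hq, hne⟩
  have hc := hT.cyc (i + 1) (by omega)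
  obtain ⟨r, h1, h2, rfl⟩ := hc.exists_eq (by positivity) hq (2 * v)
  have : r ≠ 2 * v := by rintro rfl; simp at hne
  have : r ≠ 2 * v + 1 := by rintro rfl; simp at hne
  exact mem_interior_of_inTri (hT.ad i hd v r (by omega) h2)

end Tower

lemma Cyc.ccw {m : ℕ} {q : ℤ → Pt} {S : Set Pt} (h : Cyc m q S) (hm : 0 < m) :
    CCWEnum S (fun i : Fin m => q (i.val : ℤ)) := by
  refine ⟨?_, ?_, ?_⟩
  · intro a b hab
    by_contra hne
    rcases lt_or_gt_of_ne hne with hl | hl <;> rw [Fin.lt_def] at hl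
    · exact h.inj _ _ (by exact_mod_cast hl) (by omega) hab
    · exact h.inj _ _ (by exact_mod_cast hl) (by omega) hab.symm
  · ext x; constructor
    · rintro ⟨i, rfl⟩; exact h.mem _
    · intro hx
      obtain ⟨i, h1, h2, rfl⟩ := h.exists_eq hm hx 0
      refine ⟨⟨i.toNat, by omega⟩, ?_⟩
      show q ((i.toNat : ℕ) : ℤ) = q i
      rw [Int.toNat_of_nonneg h1]
  · intro a b c hab hbc
    rw [Fin.lt_def] at hab hbc
    exact h.pos _ _ _ (by exact_mod_cast hab) (by exact_mod_cast hbc) (by omega)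

/-! ### Binary strings -/

lemma natOfStr_snoc (s : List Bool) (b : Bool) : natOfStr (s ++ [b]) = 2 * natOfStr s + b.toNat := by
  simp [natOfStr]

lemma natOfStr_lt (s : List Bool) : natOfStr s < 2 ^ s.length := by
  induction s using List.reverseRecOn with
  | nil => simp [natOfStr]
  | append_singleton s b ih =>
    rw [natOfStr_snoc, List.length_append, List.length_singleton, pow_succ]
    have := Bool.toNat_le b
    omega

lemma strOfNat_length (j i : ℕ) : (strOfNat j i).length = j := by simp [strOfNat]

lemma strOfNat_succ (j i : ℕ) : strOfNat (j + 1) i = strOfNat j (i / 2) ++ [i.testBit 0] := by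
  unfold strOfNat
  rw [List.range_succ, List.map_append]
  congr 1
  · apply List.map_congr_left
    intro t ht
    rw [List.mem_range] at ht
    rw [← Nat.testBit_succ]
    congr 1; omega
  · simp

lemma natOfStr_strOfNat (j : ℕ) : ∀ i, i < 2 ^ j → natOfStr (strOfNat j i) = i := by
  induction j with
  | zero => intro i hi; simp at hi; subst hi; rfl
  | succ j ih =>
    intro i hi
    rw [pow_succ] at hi
    rw [strOfNat_succ, natOfStr_snoc, ih _ (by omega), Nat.toNat_testBit]
    omega

lemma strOfNat_natOfStr (s : List Bool) : strOfNat s.length (natOfStr s) = s := by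
  induction s using List.reverseRecOn with
  | nil => rfl
  | append_singleton s b ih =>
    rw [natOfStr_snoc, List.length_append, List.length_singleton, strOfNat_succ]
    have hb := Bool.toNat_le b
    rw [show (2 * natOfStr s + b.toNat) / 2 = natOfStr s by cases b <;> simp <;> omega, ih]
    congr 1
    cases b <;> simp [Nat.testBit_zero]

lemma natOfStr_zeros (s : List Bool) (d : ℕ) :
    natOfStr (s ++ List.replicate d false) = natOfStr s * 2 ^ d := by
  induction d with
  | zero => simp
  | succ d ih =>
    rw [List.replicate_succ', ← List.append_assoc, natOfStr_snoc, ih]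
    simp; ring

lemma natOfStr_ones (s : List Bool) (d : ℕ) :
    natOfStr (s ++ List.replicate d true) + 1 = (natOfStr s + 1) * 2 ^ d := by
  induction d with
  | zero => simp
  | succ d ih =>
    rw [List.replicate_succ', ← List.append_assoc, natOfStr_snoc, pow_succ, ← mul_assoc, ← ih]
    simp; ring

lemma natOfStr_inj {s t : List Bool} (h : s.length = t.length) (h' : natOfStr s = natOfStr t) :
    s = t := by
  rw [← strOfNat_natOfStr s, ← strOfNat_natOfStr t, h, h']

/-! ### Labelings -/

lemma Cyc.inj_Ico {m : ℕ} {q : ℤ → Pt} {S : Set Pt} (h : Cyc m q S) {a b : ℕ} (ha : a < m)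
    (hb : b < m) (e : q (a : ℤ) = q (b : ℤ)) : a = b := by
  by_contra hne
  rcases lt_or_gt_of_ne hne with hl | hl
  · exact h.inj _ _ (by exact_mod_cast hl) (by omega) e
  · exact h.inj _ _ (by exact_mod_cast hl) (by omega) e.symm

lemma Tw.disj {k : ℕ} {Y R : ℕ → Set Pt} (h : Tw k Y R) {i j : ℕ} (hi : i ≤ k)
    (hj : j ≤ k) {p : Pt} (hp : p ∈ R i) (hp' : p ∈ R j) : i = j := by
  have key : ∀ i j, i < j → j ≤ k → p ∈ R i → p ∈ R j → False := by
    intro i j hij hj hp hp'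
    obtain ⟨d, rfl⟩ : ∃ d, j = i + d + 1 := ⟨j - i - 1, by omega⟩
    exact h.not_mem (by omega) (h.mono d (by omega) (h.rsub i hp)) hp'
  rcases lt_trichotomy i j with hl | hl | hl
  · exact (key i j hl hj hp hp').elim
  · exact hl
  · exact (key j i hl hi hp' hp).elim

lemma Tw.cover {k : ℕ} {Y R : ℕ → Set Pt} (h : Tw k Y R) {p : Pt} (j : ℕ) (hj : j ≤ k)
    (hp : p ∈ Y j) : ∃ i, 1 ≤ i ∧ i ≤ j ∧ p ∈ R i := by
  induction j with
  | zero => rw [h.y0] at hp; exact hp.elim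
  | succ j ih =>
    by_cases hr : p ∈ R (j + 1)
    · exact ⟨j + 1, by omega, le_rfl, hr⟩
    · obtain ⟨i, h1, h2, h3⟩ := ih (by omega) (by rw [h.ypred j (by omega)]; exact ⟨hp, hr⟩)
      exact ⟨i, h1, by omega, h3⟩

lemma layerSub_top (X : Set Pt) (k : ℕ) : layerSub X k k = X := by simp [layerSub]

lemma type1 {X : Set Pt} {k : ℕ} (h : Tw k (layerSub X k) (layer X k)) {Q : ℕ → ℤ → Pt}
    (hT : Tower k 2 0 (layer X k) Q) :
    ∃ x : List Bool → Pt,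
      IsLabeling1 k X x ∧ Nested1 k X x ∧ Adoptable1 k X x ∧ WellLaid1 k x := by
  have cyc : ∀ i, i + 1 ≤ k → Cyc (2 ^ (i + 1)) (Q i) (layer X k (i + 1)) := by
    intro i hi
    have := hT.cyc i (by omega)
    rwa [zero_add, mul_comm, ← pow_succ] at this
  let x : List Bool → Pt := fun s => Q (s.length - 1) (natOfStr s : ℤ)
  have xdef : ∀ (s : List Bool) (i : ℕ), s.length = i + 1 → x s = Q i (natOfStr s : ℤ) := by
    intro s i hi; simp only [x, hi, Nat.add_sub_cancel]
  have xnat : ∀ i t : ℕ, t < 2 ^ (i + 1) → x (strOfNat (i + 1) t) = Q i (t : ℤ) := by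
    intro i t ht
    rw [xdef _ i (strOfNat_length _ _), natOfStr_strOfNat _ _ ht]
  have xmem : ∀ (s : List Bool), ValidNode1 k s → x s ∈ layer X k s.length := by
    rintro s ⟨h1, h2⟩
    obtain ⟨i, hi⟩ : ∃ i, s.length = i + 1 := ⟨s.length - 1, by omega⟩
    rw [xdef s i hi, hi]
    exact (cyc i (by omega)).mem _
  refine ⟨x, ⟨?_, ?_⟩, ?_, ?_, ?_⟩
  · intro s hs t ht hst
    have hlen : s.length = t.length := h.disj hs.2 ht.2 (xmem s hs) (hst ▸ xmem t ht)
    refine natOfStr_inj hlen ?_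
    obtain ⟨i, hi⟩ : ∃ i, s.length = i + 1 := ⟨s.length - 1, by have := hs.1; omega⟩
    rw [xdef s i hi, xdef t i (by omega)] at hst
    have b1 := natOfStr_lt s
    have b2 := natOfStr_lt t
    rw [← hlen] at b2
    rw [hi] at b1 b2
    exact (cyc i (by have := hs.2; omega)).inj_Ico b1 b2 hst
  · ext p; constructor
    · rintro ⟨s, hs, rfl⟩
      have := h.rsub _ (xmem s hs)
      exact peel_iter_subset _ _ this
    · intro hp
      obtain ⟨j, h1, h2, hj⟩ := h.cover k le_rfl (p := p) (by rw [layerSub_top]; exact hp)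
      obtain ⟨i, rfl⟩ : ∃ i, j = i + 1 := ⟨j - 1, by omega⟩
      obtain ⟨t, t1, t2, rfl⟩ := (cyc i h2).exists_eq (by positivity) hj 0
      obtain ⟨u, rfl⟩ := Int.eq_ofNat_of_zero_le t1
      have hu : u < 2 ^ (i + 1) := by rw [zero_add] at t2; exact_mod_cast t2
      refine ⟨strOfNat (i + 1) u, ⟨?_, ?_⟩, xnat i u hu⟩
      · rw [strOfNat_length]; omega
      · rw [strOfNat_length]; omega
  · intro j h1 h2
    obtain ⟨i, rfl⟩ : ∃ i, j = i + 1 := ⟨j - 1, by omega⟩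
    have := (cyc i h2).ccw (by positivity)
    convert this using 2 with t
    exact xnat i _ t.2
  · intro s h1 h2
    obtain ⟨i, hi⟩ : ∃ i, s.length = i + 1 := ⟨s.length - 1, by omega⟩
    have := hT.adoptable le_rfl (i := i) (by omega) (natOfStr s)
    rw [xdef s i hi, xdef (s ++ [false]) (i + 1) (by simp [hi]),
      xdef (s ++ [true]) (i + 1) (by simp [hi]), natOfStr_snoc, natOfStr_snoc, hi]
    rw [show 0 + i + 2 = i + 1 + 1 by ring] at this
    simpa using this
  · intro s h1 h2
    obtain ⟨i, hi⟩ : ∃ i, s.length = i + 1 := ⟨s.length - 1, by omega⟩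
    obtain ⟨d, hd⟩ : ∃ d, k = i + d + 1 := ⟨k - i - 1, by omega⟩
    have hw := hT.wellLaid h le_rfl (i := i) d (by omega) (natOfStr s)
    have ek : k - s.length = d := by omega
    have n1 : natOfStr (firstStr k s) = natOfStr s * 2 ^ d := by
      unfold firstStr; rw [ek, natOfStr_zeros]
    have n2 : natOfStr (lastStr k s) + 1 = (natOfStr s + 1) * 2 ^ d := by
      unfold lastStr; rw [ek, natOfStr_ones]
    have x1 : x (firstStr k s) = Q (i + d) (natOfStr s * 2 ^ d) := by
      rw [xdef _ (i + d) (by simp [firstStr]; omega), n1]; push_cast; rfl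
    have x2 : x (lastStr k s) = Q (i + d) ((natOfStr s + 1) * 2 ^ d - 1) := by
      rw [xdef _ (i + d) (by simp [lastStr]; omega)]
      congr 1
      have : ((natOfStr (lastStr k s) + 1 : ℕ) : ℤ) = (((natOfStr s + 1) * 2 ^ d : ℕ) : ℤ) := by rw [n2]
      push_cast at this
      linarith
    have hper := (cyc (i + d) (by omega)).per
    have xm : ∀ t : ℕ, x (strOfNat k (t % 2 ^ k)) = Q (i + d) (t : ℤ) := by
      intro t
      rw [hd, xnat _ _ (Nat.mod_lt _ (by positivity)), Int.natCast_mod]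
      exact per_emod hper t
    have x3 : prev1 k x s = Q (i + d) (natOfStr s * 2 ^ d - 1) := by
      unfold prev1
      rw [xm, n1, ← hper (natOfStr s * 2 ^ d - 1), ← hd]
      congr 1
      have : 1 ≤ 2 ^ k := Nat.one_le_two_pow
      rw [Nat.cast_add, Nat.cast_sub this]
      push_cast; ring
    have x4 : next1 k x s = Q (i + d) ((natOfStr s + 1) * 2 ^ d) := by
      unfold next1
      rw [xm, n2]; push_cast; rfl
    rw [x1, x2, x3, x4, xdef s i hi]
    exact hw

lemma type2 {X : Set Pt} {k : ℕ} (hk : 1 ≤ k) (h : Tw k (layerSub X k) (layer X k))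
    {Q : ℕ → ℤ → Pt} {o : Pt} (ho : layer X k 1 = {o}) (hT : Tower k 3 1 (layer X k) Q) :
    ∃ x : Node2 → Pt,
      IsLabeling2 k X x ∧ Nested2 k X x ∧ Adoptable2 k X x ∧ WellLaid2 k x := by
  have cyc : ∀ i, i + 2 ≤ k → Cyc (3 * 2 ^ i) (Q i) (layer X k (i + 2)) := by
    intro i hi
    have := hT.cyc i (by omega)
    rwa [show 1 + i + 1 = i + 2 by ring] at this
  let x : Node2 → Pt := fun u =>
    match u with
    | none => o
    | some (c, s) => Q s.length ((c.val * 2 ^ s.length + natOfStr s : ℕ) : ℤ)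
  have xdef : ∀ (c : Fin 3) (s : List Bool) (i : ℕ), s.length = i →
      x (some (c, s)) = Q i ((c.val * 2 ^ i + natOfStr s : ℕ) : ℤ) := by
    intro c s i hi; subst hi; rfl
  have xnat : ∀ i t : ℕ, t < 3 * 2 ^ i → x (node2At i t) = Q i (t : ℤ) := by
    intro i t ht
    unfold node2At
    have hp : 0 < 2 ^ i := by positivity
    rw [xdef _ _ i (strOfNat_length _ _), natOfStr_strOfNat _ _ (Nat.mod_lt _ hp)]
    congr 2
    have : t / 2 ^ i < 3 := Nat.div_lt_of_lt_mul (by rwa [mul_comm])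
    show t / 2 ^ i % 3 * 2 ^ i + t % 2 ^ i = t
    rw [Nat.mod_eq_of_lt this]
    exact Nat.div_add_mod' t (2 ^ i)
  have xmem : ∀ (c : Fin 3) (s : List Bool), s.length + 2 ≤ k →
      x (some (c, s)) ∈ layer X k (s.length + 2) := by
    intro c s h1
    rw [xdef c s _ rfl]
    exact (cyc _ h1).mem _
  have hone : o ∈ layer X k 1 := by rw [ho]; rfl
  refine ⟨x, ⟨?_, ?_⟩, ⟨?_, ?_⟩, ?_, ?_⟩
  · rintro (_ | ⟨c, s⟩) hs (_ | ⟨c', t⟩) ht hst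
    · rfl
    · have ht' : t.length + 2 ≤ k := ht
      have h2 := xmem c' t ht'
      rw [← hst] at h2
      have := h.disj hk ht' hone h2
      omega
    · have hs' : s.length + 2 ≤ k := hs
      have h2 := xmem c s hs'
      rw [hst] at h2
      have := h.disj hk hs' hone h2
      omega
    · have hs' : s.length + 2 ≤ k := hs
      have ht' : t.length + 2 ≤ k := ht
      have hl := h.disj hs' ht' (xmem c s hs') (hst ▸ xmem c' t ht')
      have hlen : t.length = s.length := by omega
      rw [xdef c s _ rfl, xdef c' t _ hlen] at hst
      have b1 := natOfStr_lt s
      have b2 := natOfStr_lt t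
      rw [hlen] at b2
      have hc := c.2
      have hc' := c'.2
      have bd : ∀ (a n : ℕ), a < 3 → n < 2 ^ s.length → a * 2 ^ s.length + n < 3 * 2 ^ s.length := by
        intro a n ha hn
        have : (a + 1) * 2 ^ s.length ≤ 3 * 2 ^ s.length := Nat.mul_le_mul_right _ (by omega)
        rw [add_mul] at this
        omega
      have e := (cyc s.length hs').inj_Ico (bd _ _ hc b1) (bd _ _ hc' b2) hst
      have e1 : c.val = c'.val := by
        have : (c.val * 2 ^ s.length + natOfStr s) / 2 ^ s.length =
            (c'.val * 2 ^ s.length + natOfStr t) / 2 ^ s.length := by rw [e]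
        rw [mul_comm, mul_comm c'.val, Nat.mul_add_div (by positivity),
          Nat.mul_add_div (by positivity), Nat.div_eq_of_lt b1, Nat.div_eq_of_lt b2] at this
        simpa using this
      have e2 : natOfStr s = natOfStr t := by rw [e1] at e; omega
      rw [Fin.ext e1, natOfStr_inj hlen.symm e2]
  · ext p; constructor
    · rintro ⟨u, hu, rfl⟩
      rcases u with _ | ⟨c, s⟩
      · exact peel_iter_subset _ _ (h.rsub _ hone)
      · exact peel_iter_subset _ _ (h.rsub _ (xmem c s hu))
    · intro hp
      obtain ⟨j, h1, h2, hj⟩ := h.cover k le_rfl (p := p) (by rw [layerSub_top]; exact hp)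
      by_cases hj1 : j = 1
      · subst hj1
        rw [ho] at hj
        exact ⟨none, trivial, (Set.mem_singleton_iff.1 hj).symm⟩
      obtain ⟨i, rfl⟩ : ∃ i, j = i + 2 := ⟨j - 2, by omega⟩
      obtain ⟨t, t1, t2, rfl⟩ := (cyc i h2).exists_eq (by positivity) hj 0
      obtain ⟨u, rfl⟩ := Int.eq_ofNat_of_zero_le t1
      have hu : u < 3 * 2 ^ i := by rw [zero_add] at t2; exact_mod_cast t2
      refine ⟨node2At i u, ?_, xnat i u hu⟩
      show (strOfNat i _).length + 2 ≤ k
      rw [strOfNat_length]; exact h2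
  · refine ⟨fun a b _ => Subsingleton.elim a b, ?_, fun a b _ hab => ?_⟩
    · rw [ho]; ext p; simp [x, eq_comm]
    · exact absurd hab (by rw [Subsingleton.elim a b]; exact lt_irrefl _)
  · intro i hi
    have := (cyc i hi).ccw (by positivity)
    convert this using 2 with t
    exact xnat i _ t.2
  · intro c s h1
    have := hT.adoptable (by norm_num) (i := s.length) (by omega)
      ((c.val * 2 ^ s.length + natOfStr s : ℕ) : ℤ)
    rw [xdef c s _ rfl, xdef c (s ++ [false]) (s.length + 1) (by simp),
      xdef c (s ++ [true]) (s.length + 1) (by simp), natOfStr_snoc, natOfStr_snoc]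
    rw [show 1 + s.length + 2 = s.length + 3 by ring] at this
    convert this using 2
    · simp only [Bool.toNat_false]; push_cast; ring
    · simp only [Bool.toNat_true]; push_cast; ring
  · intro c s h1
    obtain ⟨d, hd⟩ : ∃ d, k = s.length + d + 2 := ⟨k - s.length - 2, by omega⟩
    have hw := hT.wellLaid h (by norm_num) (i := s.length) d (by omega)
      ((c.val * 2 ^ s.length + natOfStr s : ℕ) : ℤ)
    have ek2 : k - 2 = s.length + d := by omega
    have ek : k - 2 - s.length = d := by omega
    have n1 : natOfStr (firstStr (k - 2) s) = natOfStr s * 2 ^ d := by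
      unfold firstStr; rw [ek, natOfStr_zeros]
    have n2 : natOfStr (lastStr (k - 2) s) + 1 = (natOfStr s + 1) * 2 ^ d := by
      unfold lastStr; rw [ek, natOfStr_ones]
    have n2' : (natOfStr (lastStr (k - 2) s) : ℤ) = (natOfStr s + 1) * 2 ^ d - 1 := by
      have : ((natOfStr (lastStr (k - 2) s) + 1 : ℕ) : ℤ) = (((natOfStr s + 1) * 2 ^ d : ℕ) : ℤ) := by
        rw [n2]
      push_cast at this
      linarith
    set V : ℤ := ((c.val * 2 ^ s.length + natOfStr s : ℕ) : ℤ) with hV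
    have hV' : V = c.val * 2 ^ s.length + natOfStr s := by rw [hV]; push_cast; rfl
    have x1 : x (some (c, firstStr (k - 2) s)) = Q (s.length + d) (V * 2 ^ d) := by
      rw [xdef _ _ (s.length + d) (by simp [firstStr]; omega), n1, hV']
      congr 1; push_cast; ring
    have x2 : x (some (c, lastStr (k - 2) s)) = Q (s.length + d) ((V + 1) * 2 ^ d - 1) := by
      rw [xdef _ _ (s.length + d) (by simp [lastStr]; omega), hV']
      congr 1; push_cast; rw [n2']; ring
    have hper := (cyc (s.length + d) (by omega)).per
    have xm : ∀ t : ℕ, x (node2At (k - 2) (t % (3 * 2 ^ (k - 2)))) = Q (s.length + d) (t : ℤ) := by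
      intro t
      rw [ek2, xnat _ _ (Nat.mod_lt _ (by positivity)), Int.natCast_mod]
      exact per_emod hper t
    have x3 : prev2 k x c s = Q (s.length + d) (V * 2 ^ d - 1) := by
      unfold prev2
      rw [xm, n1, ← hper (V * 2 ^ d - 1), ek2, hV']
      congr 1
      have : 1 ≤ 3 * 2 ^ (s.length + d) := Nat.one_le_iff_ne_zero.2 (by positivity)
      rw [Nat.cast_add, Nat.cast_sub this]
      push_cast; ring
    have x4 : next2 k x c s = Q (s.length + d) ((V + 1) * 2 ^ d) := by
      unfold next2
      rw [xm, ek2, hV']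
      congr 1; rw [← ek2]; push_cast; rw [n2', ek2]; ring
    rw [x1, x2, x3, x4, xdef c s _ rfl]
    exact hw

/-- (Theorem 2, (1) ⇒ (2).) Every nested almost convex set admits a labeling
(type 1 or type 2) that is nested, adoptable and well laid. -/
theorem nacs_exists_labeling (X : Set Pt) (hX : IsNACS X) :
    ∃ k : ℕ, 1 ≤ k ∧ HasLayers X k ∧
      ((∃ x : List Bool → Pt,
          IsLabeling1 k X x ∧ Nested1 k X x ∧ Adoptable1 k X x ∧ WellLaid1 k x) ∨
        (∃ x : Node2 → Pt,
          IsLabeling2 k X x ∧ Nested2 k X x ∧ Adoptable2 k X x ∧ WellLaid2 k x)) := by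
  obtain ⟨k, hk1, hk⟩ := exists_hasLayers hX.1 hX.2.1
  have h := tw_of_nacs hX hk
  refine ⟨k, hk1, hk, ?_⟩
  rcases h.card_one hk1 with h1 | h1
  · right
    obtain ⟨o, ho⟩ := Set.ncard_eq_one.1 h1
    have hQ : ∃ Q, Tower k 3 1 (layer X k) Q := by
      by_cases hk2 : 2 ≤ k
      · refine exists_tower h (by norm_num) hk2 ?_ ?_
        · rw [h.card_two hk2, h1]
        · intro i hi
          exact h.card_double (j := 1 + i + 1) (by omega) (by omega)
      · exact ⟨fun _ _ => 0, fun i hi => by omega, fun i hi => by omega⟩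
    obtain ⟨Q, hQ⟩ := hQ
    exact type2 hk1 h ho hQ
  · left
    have hQ : ∃ Q, Tower k 2 0 (layer X k) Q := by
      refine exists_tower h le_rfl hk1 h1 ?_
      intro i hi
      rcases Nat.eq_zero_or_pos i with rfl | hpos
      · have := h.card_two hi
        rw [h1] at this
        show (layer X k 2).ncard = 2 * (layer X k 1).ncard
        rw [this, h1]
      · exact h.card_double (j := 0 + i + 1) (by omega) (by omega)
    obtain ⟨Q, hQ⟩ := hQ
    exact type1 h hQ
end
end
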